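/- If u, v are positive C² functions on Ω̄ with λ(A(u)), λ(A(v)) ∈ Γ_k pointwise, u ≥ v in Ω and u = v on ∂Ω, and w_t = (1−t)u + tv, then for α ≥ 0 the function t ↦ ∫_Ω Σ_{l=0}^k b_l w_t^α |∇w_t|^{2l} S_{k−l}(w_t) dx is nondecreasing in t ∈ [0,1], where b_l = [(k+l)α + kn + 2kl]·(α+n+l−1)!/(2^l l!(α+n)!); in particular ∫_Ω Σ_l b_l u^α|∇u|^{2l}S_{k−l}(u) ≤ ∫_Ω Σ_l b_l v^α|∇v|^{2l}S_{k−l}(v). -/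

import Mathlib

open scoped BigOperators Classical
open MeasureTheory

noncomputable section

abbrev E (n : ℕ) := EuclideanSpace ℝ (Fin n)

/-- k-th elementary symmetric polynomial of a vector in ℝⁿ. -/
def esymm (n k : ℕ) (lam : Fin n → ℝ) : ℝ :=
  ∑ s ∈ Finset.univ.powersetCard k, ∏ i ∈ s, lam i

/-- Eigenvalue vector of a real symmetric matrix (junk value 0 otherwise). -/
def eigs {n : ℕ} (M : Matrix (Fin n) (Fin n) ℝ) : Fin n → ℝ :=
  if h : M.IsHermitian then h.eigenvalues else 0

/-- σ_k of the eigenvalues of a symmetric matrix. -/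
def Sk (n k : ℕ) (M : Matrix (Fin n) (Fin n) ℝ) : ℝ := esymm n k (eigs M)

/-- The (closed) Gårding cone Γ_k. -/
def GammaK (n k : ℕ) : Set (Fin n → ℝ) :=
  {lam | ∀ i, 1 ≤ i → i ≤ k → 0 ≤ esymm n i lam}

/-- i-th partial derivative. -/
def pd {n : ℕ} (u : E n → ℝ) (i : Fin n) (x : E n) : ℝ :=
  fderiv ℝ u x (EuclideanSpace.single i 1)

/-- Hessian matrix. -/
def hess {n : ℕ} (u : E n → ℝ) (x : E n) : Matrix (Fin n) (Fin n) ℝ :=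
  Matrix.of fun i j => pd (fun y => pd u j y) i x

/-- |∇u|². -/
def gradsq {n : ℕ} (u : E n → ℝ) (x : E n) : ℝ := ∑ i, (pd u i x) ^ 2

/-- The conformal Schouten-type matrix A_{ij}(u) = u u_{ij} - (1/2)|∇u|² δ_{ij}. -/
def Amat {n : ℕ} (u : E n → ℝ) (x : E n) : Matrix (Fin n) (Fin n) ℝ :=
  Matrix.of fun i j => u x * hess u x i j - (1 / 2) * gradsq u x * (if i = j then 1 else 0)

/-- Pochhammer-type product (x+1)(x+2)⋯(x+l). -/
def poch (x : ℝ) (l : ℕ) : ℝ := ∏ i ∈ Finset.range l, (x + i + 1)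

/-- a_l = −(α+n+l)!/(2^l l! (α+n)!). -/
def acoef (n : ℕ) (α : ℝ) (l : ℕ) : ℝ := -(poch (α + n) l) / (2 ^ l * Nat.factorial l)

/-- b_0 = k, b_l = [(k+l)α + kn + 2kl]·(α+n+l−1)!/(2^l l! (α+n)!). -/
def bcoef (n k : ℕ) (α : ℝ) : ℕ → ℝ
  | 0 => k
  | (l + 1) => (((k : ℝ) + l + 1) * α + k * n + 2 * k * (l + 1)) * poch (α + n) l /
      (2 ^ (l + 1) * Nat.factorial (l + 1))

/-! ## Part A: elementary symmetric functions on finsets, the Garding cone -/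

def es {ι : Type*} (s : Finset ι) (k : ℕ) (f : ι → ℝ) : ℝ :=
  ∑ t ∈ s.powersetCard k, ∏ i ∈ t, f i

lemma es_zero {ι : Type*} (s : Finset ι) (f : ι → ℝ) : es s 0 f = 1 := by
  simp [es]

lemma es_insert {ι : Type*} {s : Finset ι} {a : ι} (ha : a ∉ s) (k : ℕ) (f : ι → ℝ) :
    es (insert a s) (k + 1) f = es s (k + 1) f + f a * es s k f := by
  unfold es
  rw [Finset.powersetCard_succ_insert ha, Finset.sum_union, Finset.sum_image, Finset.mul_sum]
  · congr 1
    apply Finset.sum_congr rfl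
    intro t ht
    rw [Finset.prod_insert]
    intro h
    exact ha ((Finset.mem_powersetCard.1 ht).1 h)
  · intro t ht t' ht' h
    have h1 : a ∉ t := fun h => ha ((Finset.mem_powersetCard.1 ht).1 h)
    have h2 : a ∉ t' := fun h => ha ((Finset.mem_powersetCard.1 ht').1 h)
    rw [← Finset.erase_insert h1, ← Finset.erase_insert h2, h]
  · rw [Finset.disjoint_left]
    intro t ht ht'
    obtain ⟨r, hr, rfl⟩ := Finset.mem_image.1 ht'
    exact ha ((Finset.mem_powersetCard.1 ht).1 (Finset.mem_insert_self _ _))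

lemma es_erase {ι : Type*} {s : Finset ι} {a : ι} (ha : a ∈ s) (k : ℕ) (f : ι → ℝ) :
    es s (k + 1) f = es (s.erase a) (k + 1) f + f a * es (s.erase a) k f := by
  conv_lhs => rw [← Finset.insert_erase ha]
  exact es_insert (Finset.notMem_erase a s) k f

lemma es_eq_zero {ι : Type*} (s : Finset ι) (k : ℕ) (h : s.card < k) (f : ι → ℝ) :
    es s k f = 0 := by
  simp [es, Finset.powersetCard_eq_empty.2 h]

/-- `∑ i, f i * σ_{k;i} = (k+1) σ_{k+1}` -/
lemma sum_mul_es_erase {ι : Type*} (s : Finset ι) (k : ℕ) (f : ι → ℝ) :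
    ∑ i ∈ s, f i * es (s.erase i) k f = (k + 1) * es s (k + 1) f := by
  induction s using Finset.induction_on generalizing k with
  | empty => simp [es_eq_zero (∅ : Finset ι) (k + 1) (by simp)]
  | insert a s ha ih =>
    rw [Finset.sum_insert ha, Finset.erase_insert ha, es_insert ha]
    have h1 : ∀ i ∈ s, (insert a s).erase i = insert a (s.erase i) := by
      intro i hi
      rw [Finset.erase_insert_of_ne]
      rintro rfl; exact ha hi
    cases k with
    | zero =>
      have := ih 0
      simp only [es_zero] at this ⊢
      rw [this]; push_cast; ring
    | succ k =>
      have h2 : ∀ i ∈ s, f i * es ((insert a s).erase i) (k + 1) f =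
          f i * es (s.erase i) (k + 1) f + f a * (f i * es (s.erase i) k f) := by
        intro i hi
        rw [h1 i hi, es_insert (fun h => ha (Finset.mem_of_mem_erase h))]
        ring
      rw [Finset.sum_congr rfl h2, Finset.sum_add_distrib, ← Finset.mul_sum, ih, ih]
      push_cast; ring

open Polynomial in
lemma splits_deriv (p : ℝ[X]) (h : p.Splits) : (derivative p).Splits := by
  by_cases h0 : derivative p = 0
  · rw [h0]; exact Splits.zero
  rw [splits_iff_card_roots] at h ⊢
  have h1 := card_roots_le_derivative p
  have h2 := natDegree_derivative_lt (p := p) (by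
    intro h3
    apply h0
    exact derivative_of_natDegree_zero h3)
  have h3 := card_roots' (derivative p)
  omega

open Polynomial in
lemma splits_iter (p : ℝ[X]) (h : p.Splits) (m : ℕ) : (derivative^[m] p).Splits := by
  induction m with
  | zero => simpa
  | succ m ih => rw [Function.iterate_succ_apply']; exact splits_deriv _ ih

open Polynomial in
/-- Laguerre's inequality -/
lemma laguerre (p : ℝ[X]) (h : p.Splits) (x : ℝ) :
    p.eval x * (derivative (derivative p)).eval x ≤ ((derivative p).eval x) ^ 2 := by
  unfold Splits at h
  induction h using Submonoid.closure_induction with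
  | mem p hp =>
    rcases hp with ⟨a, rfl⟩ | ⟨a, rfl⟩
    · simp
    · simp
  | one => simp
  | mul p q _ _ hp hq =>
    simp only [derivative_mul, eval_add, eval_mul, derivative_add]
    nlinarith [mul_nonneg (sq_nonneg (p.eval x)) (sub_nonneg.2 hq),
      mul_nonneg (sq_nonneg (q.eval x)) (sub_nonneg.2 hp)]

open Polynomial in
lemma newton_es {ι : Type*} (s : Finset ι) (k : ℕ) (f : ι → ℝ) :
    es s k f * es s (k + 2) f ≤ (es s (k + 1) f) ^ 2 := by
  by_cases hk : s.card < k + 2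
  · rw [es_eq_zero s (k+2) hk, mul_zero]; positivity
  by_cases hneg : es s k f * es s (k + 2) f ≤ 0
  · exact hneg.trans (sq_nonneg _)
  push Not at hk hneg
  obtain ⟨m, hm⟩ := Nat.exists_eq_add_of_le hk
  set p : ℝ[X] := ∏ i ∈ s, (X + C (f i)) with hp
  have hs : p.Splits := Splits.prod fun i _ => Splits.X_add_C _
  have hc : ∀ j, j ≤ s.card → p.coeff j = es s (s.card - j) f := by
    intro j hj
    rw [hp, Finset.prod_X_add_C_coeff s f hj]; rfl
  have hl := laguerre _ (splits_iter p hs m) 0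
  rw [← Function.iterate_succ_apply' derivative, ← Function.iterate_succ_apply' derivative] at hl
  have he : ∀ j, (derivative^[j] p).eval 0 = j.factorial * p.coeff j := by
    intro j
    rw [← coeff_zero_eq_eval_zero, coeff_iterate_derivative]
    simp [Nat.descFactorial_self]
  rw [he, he, he, hc _ (by omega), hc _ (by omega), hc _ (by omega)] at hl
  have e1 : s.card - m = k + 2 := by omega
  have e2 : s.card - (m + 1) = k + 1 := by omega
  have e3 : s.card - (m + 1 + 1) = k := by omega
  simp only [Nat.succ_eq_add_one] at hl
  rw [e1, e2, e3] at hl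
  have hf : (0 : ℝ) < (m.factorial : ℝ) := by positivity
  have f1 : ((m + 1).factorial : ℝ) = (m + 1) * m.factorial := by
    rw [Nat.factorial_succ]; push_cast; ring
  have f2 : ((m + 1 + 1).factorial : ℝ) = (m + 2) * ((m + 1) * m.factorial) := by
    rw [Nat.factorial_succ, Nat.factorial_succ]; push_cast; ring
  rw [f1, f2] at hl
  have hmm : (0 : ℝ) ≤ m := by positivity
  have h3 : (m + 2 : ℝ) * (es s k f * es s (k + 2) f) ≤ (m + 1) * (es s (k + 1) f) ^ 2 := by
    have hpos : (0 : ℝ) < (m.factorial : ℝ) ^ 2 * (m + 1) := by positivity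
    nlinarith
  nlinarith

/-- open cone -/
def OG {ι : Type*} (s : Finset ι) (k : ℕ) (f : ι → ℝ) : Prop := ∀ j, j ≤ k → 0 < es s j f

lemma OG_mono {ι : Type*} {s : Finset ι} {k l : ℕ} {f : ι → ℝ} (h : OG s k f) (hl : l ≤ k) :
    OG s l f := fun j hj => h j (hj.trans hl)

lemma OG_erase {ι : Type*} {s : Finset ι} {k : ℕ} {f : ι → ℝ} (h : OG s (k + 1) f) {a : ι}
    (ha : a ∈ s) : OG (s.erase a) k f := by
  induction k with
  | zero =>
    intro j hj
    obtain rfl : j = 0 := by omega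
    rw [es_zero]; norm_num
  | succ k ih =>
    have ih' := ih (OG_mono h (by omega))
    intro j hj
    rcases Nat.lt_or_ge j (k + 1) with hj' | hj'
    · exact ih' j (by omega)
    obtain rfl : j = k + 1 := by omega
    by_contra hcon
    push Not at hcon
    have h1 := h (k + 1) (by omega)
    have h2 := h (k + 2) (by omega)
    rw [es_erase ha] at h1 h2
    have h3 := newton_es (s.erase a) k f
    have h4 := ih' k le_rfl
    have h0 : 0 < f a := by
      by_contra hh
      push Not at hh
      nlinarith
    nlinarith

lemma sq_div_add_le {a b x y z : ℝ} (hx : 0 < x) (hy : 0 < y) (hz : x + y ≤ z) :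
    (a + b) ^ 2 / z ≤ a ^ 2 / x + b ^ 2 / y := by
  have h1 : (a + b) ^ 2 / z ≤ (a + b) ^ 2 / (x + y) := by gcongr
  refine h1.trans ?_
  rw [div_add_div _ _ hx.ne' hy.ne', div_le_div_iff₀ (by positivity) (by positivity)]
  have : (a ^ 2 * y + x * b ^ 2) * (x + y) - (a + b) ^ 2 * (x * y) = (a * y - b * x) ^ 2 := by ring
  nlinarith [sq_nonneg (a * y - b * x)]

lemma es_quot {ι : Type*} {s : Finset ι} {k : ℕ} {f : ι → ℝ} (h : OG s (k + 1) f) :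
    ((k : ℝ) + 2) * (es s (k + 2) f / es s (k + 1) f) =
      ∑ i ∈ s, (f i - f i ^ 2 / (f i + es (s.erase i) (k + 1) f / es (s.erase i) k f)) := by
  have h1 := sum_mul_es_erase s (k + 1) f
  have hp := h (k + 1) le_rfl
  rw [mul_div_assoc', eq_comm]
  rw [eq_div_iff hp.ne', Finset.sum_mul]
  push_cast at h1
  have : (k : ℝ) + 1 + 1 = k + 2 := by ring
  rw [this] at h1
  rw [← h1]
  apply Finset.sum_congr rfl
  intro i hi
  have h2 := OG_erase h hi k le_rfl
  have h3 := es_erase hi k f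
  have h4 : f i + es (s.erase i) (k + 1) f / es (s.erase i) k f
      = es s (k + 1) f / es (s.erase i) k f := by
    rw [h3]; field_simp; ring
  rw [h4, div_div_eq_mul_div, sub_mul, div_mul_cancel₀ _ hp.ne', h3]
  ring

lemma OG_super {ι : Type*} (k : ℕ) : ∀ (s : Finset ι) (f g : ι → ℝ), OG s k f → OG s k g →
    OG s k (fun i => f i + g i) ∧
    es s (k + 1) f / es s k f + es s (k + 1) g / es s k g ≤
      es s (k + 1) (fun i => f i + g i) / es s k (fun i => f i + g i) := by
  induction k with
  | zero =>
    intro s f g hf hg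
    refine ⟨?_, ?_⟩
    · intro j hj
      obtain rfl : j = 0 := by omega
      rw [es_zero]; norm_num
    · have := fun f : ι → ℝ => sum_mul_es_erase s 0 f
      simp only [es_zero, mul_one, Nat.cast_zero, zero_add, one_mul] at this
      simp only [es_zero, zero_add, ← this, div_one, Finset.sum_add_distrib, le_refl]
  | succ k ih =>
    intro s f g hf hg
    have hs := ih s f g (OG_mono hf (by omega)) (OG_mono hg (by omega))
    have hfg : OG s (k + 1) (fun i => f i + g i) := by
      intro j hj
      rcases Nat.lt_or_ge j (k + 1) with hj' | hj'
      · exact hs.1 j (by omega)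
      obtain rfl : j = k + 1 := by omega
      have h1 : 0 < es s (k + 1) (fun i => f i + g i) / es s k (fun i => f i + g i) :=
        lt_of_lt_of_le (add_pos (div_pos (hf _ le_rfl) (hf _ (by omega)))
          (div_pos (hg _ le_rfl) (hg _ (by omega)))) hs.2
      have h2 := hs.1 k le_rfl
      by_contra hcon
      push Not at hcon
      exact absurd h1 (not_lt.2 (div_nonpos_of_nonpos_of_nonneg hcon h2.le))
    refine ⟨hfg, ?_⟩
    have key : ((k : ℝ) + 2) * (es s (k + 2) f / es s (k + 1) f) +
        ((k : ℝ) + 2) * (es s (k + 2) g / es s (k + 1) g) ≤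
        ((k : ℝ) + 2) * (es s (k + 2) (fun i => f i + g i) / es s (k + 1) (fun i => f i + g i)) := by
      rw [es_quot hf, es_quot hg, es_quot hfg, ← Finset.sum_add_distrib]
      apply Finset.sum_le_sum
      intro i hi
      have hpos : ∀ f : ι → ℝ, OG s (k + 1) f →
          0 < f i + es (s.erase i) (k + 1) f / es (s.erase i) k f := by
        intro f hf
        have h2 := OG_erase hf hi k le_rfl
        have h3 := es_erase hi k f
        have h4 : f i + es (s.erase i) (k + 1) f / es (s.erase i) k f
            = es s (k + 1) f / es (s.erase i) k f := by
          rw [h3]; field_simp; ring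
        rw [h4]
        exact div_pos (hf _ le_rfl) h2
      have h5 := (ih (s.erase i) f g (OG_erase hf hi) (OG_erase hg hi)).2
      have h6 := sq_div_add_le (a := f i) (b := g i) (hpos f hf) (hpos g hg)
        (z := (f i + g i) + es (s.erase i) (k + 1) (fun i => f i + g i) /
          es (s.erase i) k (fun i => f i + g i)) (by linarith)
      linarith
    have hk : (0 : ℝ) < k + 2 := by positivity
    rw [← mul_add] at key
    exact le_of_mul_le_mul_left key hk

lemma prod_add_mul_es {R : Type*} [CommRing R] [Algebra ℝ R] {ι : Type*} (s : Finset ι)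
    (a b : R) (f : ι → ℝ) :
    ∏ i ∈ s, (a + b * algebraMap ℝ R (f i)) =
      ∑ j ∈ Finset.range (s.card + 1), a ^ (s.card - j) * b ^ j * algebraMap ℝ R (es s j f) := by
  rw [Finset.prod_congr rfl (fun i _ => add_comm a (b * algebraMap ℝ R (f i))), Finset.prod_add,
    Finset.sum_powerset]
  apply Finset.sum_congr rfl
  intro j _
  unfold es
  rw [map_sum, Finset.mul_sum]
  apply Finset.sum_congr rfl
  intro t ht
  obtain ⟨h1, h2⟩ := Finset.mem_powersetCard.1 ht
  rw [Finset.prod_mul_distrib, Finset.prod_const, Finset.prod_const, h2, map_prod,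
    Finset.card_sdiff_of_subset h1, h2]
  ring

open Polynomial in
lemma es_shift {ι : Type*} (s : Finset ι) (j : ℕ) (hj : j ≤ s.card) (f : ι → ℝ) (ε : ℝ) :
    es s j (fun i => f i + ε) = ∑ i ∈ Finset.range (s.card + 1),
      ε ^ (s.card - i - (s.card - j)) * ((s.card - i).choose (s.card - j) : ℝ) * es s i f := by
  have h1 := Finset.prod_X_add_C_coeff s (fun i => f i + ε) (k := s.card - j) (by omega)
  have h2 : s.card - (s.card - j) = j := by omega
  rw [h2] at h1
  have h3 := prod_add_mul_es s ((X : ℝ[X]) + C ε) 1 f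
  have h4 : ∏ i ∈ s, ((X : ℝ[X]) + C (f i + ε)) =
      ∏ i ∈ s, ((X : ℝ[X]) + C ε + 1 * algebraMap ℝ ℝ[X] (f i)) := by
    apply Finset.prod_congr rfl
    intro i _
    rw [← C_eq_algebraMap, C_add]; ring
  rw [h4, h3] at h1
  unfold es at h1 ⊢
  rw [← h1, finsetSum_coeff]
  apply Finset.sum_congr rfl
  intro i _
  rw [← C_eq_algebraMap, coeff_mul_C, one_pow, mul_one, coeff_X_add_C_pow]

/-- closed cone -/
def CG {ι : Type*} (s : Finset ι) (k : ℕ) (f : ι → ℝ) : Prop := ∀ j, j ≤ k → 0 ≤ es s j f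

lemma CG_shift {ι : Type*} {s : Finset ι} {k : ℕ} (hk : k ≤ s.card) {f : ι → ℝ}
    (h : CG s k f) {ε : ℝ} (hε : 0 < ε) : OG s k (fun i => f i + ε) := by
  intro j hj
  rw [es_shift s j (by omega)]
  apply Finset.sum_pos'
  · intro i hi
    rcases Nat.lt_or_ge j i with hji | hji
    · rw [Nat.choose_eq_zero_of_lt (by simp at hi; omega)]; simp
    · have := h i (by omega)
      positivity
  · refine ⟨0, by simp, ?_⟩
    rw [es_zero]
    have : 0 < (s.card - 0).choose (s.card - j) := Nat.choose_pos (by omega)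
    positivity

lemma es_continuous {ι : Type*} (s : Finset ι) (k : ℕ) : Continuous (es s k) := by
  unfold es
  fun_prop

lemma CG_add {ι : Type*} {s : Finset ι} {k : ℕ} (hk : k ≤ s.card) {f g : ι → ℝ}
    (hf : CG s k f) (hg : CG s k g) : CG s k (fun i => f i + g i) := by
  intro j hj
  have h1 : ∀ ε : ℝ, 0 < ε → 0 ≤ es s j (fun i => (f i + ε) + (g i + ε)) := fun ε hε =>
    ((OG_super k s _ _ (CG_shift hk hf hε) (CG_shift hk hg hε)).1 j hj).le
  have h2 : Continuous (fun ε : ℝ => es s j (fun i => (f i + ε) + (g i + ε))) :=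
    (es_continuous s j).comp (by fun_prop)
  have h3 := (h2.tendsto 0).mono_left (nhdsWithin_le_nhds (s := Set.Ioi 0))
  simp only [add_zero] at h3
  refine ge_of_tendsto h3 ?_
  filter_upwards [self_mem_nhdsWithin] with ε hε using h1 ε hε

lemma es_smul {ι : Type*} (s : Finset ι) (k : ℕ) (f : ι → ℝ) (c : ℝ) :
    es s k (fun i => c * f i) = c ^ k * es s k f := by
  unfold es
  rw [Finset.mul_sum]
  apply Finset.sum_congr rfl
  intro t ht
  rw [Finset.prod_mul_distrib, Finset.prod_const, (Finset.mem_powersetCard.1 ht).2]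

lemma CG_smul {ι : Type*} {s : Finset ι} {k : ℕ} {f : ι → ℝ} {c : ℝ} (hc : 0 ≤ c)
    (hf : CG s k f) : CG s k (fun i => c * f i) := by
  intro j hj
  rw [es_smul]
  exact mul_nonneg (pow_nonneg hc _) (hf j hj)

lemma CG_of_nonneg {ι : Type*} {s : Finset ι} {k : ℕ} {f : ι → ℝ} (hf : ∀ i, 0 ≤ f i) :
    CG s k f := by
  intro j _
  exact Finset.sum_nonneg fun t _ => Finset.prod_nonneg fun i _ => hf i

lemma CG_sum {ι κ : Type*} {s : Finset ι} {k : ℕ} (hk : k ≤ s.card) (r : Finset κ)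
    (f : κ → ι → ℝ) (h : ∀ a ∈ r, CG s k (f a)) : CG s k (fun i => ∑ a ∈ r, f a i) := by
  induction r using Finset.induction_on with
  | empty => exact CG_of_nonneg (by simp)
  | insert a r ha ih =>
    simp only [Finset.sum_insert ha]
    exact CG_add hk (h a (by simp)) (ih fun b hb => h b (by simp [hb]))

lemma es_perm {ι : Type*} [Fintype ι] (k : ℕ) (f : ι → ℝ) (e : Equiv.Perm ι) :
    es Finset.univ k (fun i => f (e i)) = es Finset.univ k f := by
  unfold es
  refine Finset.sum_bij (fun t _ => t.map e.toEmbedding) ?_ ?_ ?_ ?_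
  · intro t ht; simpa using ht
  · intro t _ t' _ h; exact Finset.map_injective _ h
  · intro t ht
    refine ⟨t.map e.symm.toEmbedding, by simpa using ht, ?_⟩
    ext x; simp
  · intro t _; simp

/-- Doubly stochastic images stay in the cone. -/
lemma CG_ds {n k : ℕ} (hk : k ≤ n) {f : Fin n → ℝ} (hf : CG Finset.univ k f)
    {M : Matrix (Fin n) (Fin n) ℝ} (hM : M ∈ doublyStochastic ℝ (Fin n)) :
    CG Finset.univ k (M.mulVec f) := by
  obtain ⟨w, hw, -, rfl⟩ := exists_eq_sum_perm_of_mem_doublyStochastic hM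
  have : ((∑ σ, w σ • σ.permMatrix ℝ).mulVec f) =
      fun i => ∑ σ : Equiv.Perm (Fin n), w σ * f (σ i) := by
    ext i
    rw [Matrix.sum_mulVec, Finset.sum_apply]
    apply Finset.sum_congr rfl
    intro σ _
    rw [Matrix.smul_mulVec, Matrix.permMatrix_mulVec]
    simp
  rw [this]
  apply CG_sum (by simpa using hk)
  intro σ _
  apply CG_smul (hw σ)
  intro j hj
  rw [es_perm]
  exact hf j hj

/-! ## Part B: Faddeev-LeVerrier recursion, Newton tensors -/

section FL
variable {R : Type*} [CommRing R] [Algebra ℝ R] {n : ℕ}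

def FL (M : Matrix (Fin n) (Fin n) R) : ℕ → R × Matrix (Fin n) (Fin n) R
  | 0 => (1, 1)
  | (i + 1) =>
    ((1 / ((i : ℝ) + 1)) • (M * (FL M i).2).trace,
      ((1 / ((i : ℝ) + 1)) • (M * (FL M i).2).trace) • (1 : Matrix (Fin n) (Fin n) R)
        - M * (FL M i).2)

def HH (i : ℕ) (M : Matrix (Fin n) (Fin n) R) : R := (FL M i).1
def NT (i : ℕ) (M : Matrix (Fin n) (Fin n) R) : Matrix (Fin n) (Fin n) R := (FL M i).2

lemma HH_zero (M : Matrix (Fin n) (Fin n) R) : HH 0 M = 1 := rfl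
lemma NT_zero (M : Matrix (Fin n) (Fin n) R) : NT 0 M = 1 := rfl
lemma HH_succ (i : ℕ) (M : Matrix (Fin n) (Fin n) R) :
    HH (i + 1) M = (1 / ((i : ℝ) + 1)) • (M * NT i M).trace := rfl
lemma NT_succ (i : ℕ) (M : Matrix (Fin n) (Fin n) R) :
    NT (i + 1) M = HH (i + 1) M • (1 : Matrix (Fin n) (Fin n) R) - M * NT i M := rfl

lemma trace_NT (i : ℕ) (M : Matrix (Fin n) (Fin n) R) :
    (M * NT i M).trace = ((i : R) + 1) * HH (i + 1) M := by
  have h : ((i : ℝ) + 1) ≠ 0 := by positivity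
  have h2 : ((i : R) + 1) = algebraMap ℝ R ((i : ℝ) + 1) := by simp
  rw [HH_succ, h2, ← Algebra.smul_def, smul_smul, mul_one_div_cancel h, one_smul]

lemma NT_eq_sum (i : ℕ) (M : Matrix (Fin n) (Fin n) R) :
    NT i M = ∑ j ∈ Finset.range (i + 1), ((-1) ^ j * HH (i - j) M) • M ^ j := by
  induction i with
  | zero => simp [NT_zero, HH_zero]
  | succ i ih =>
    rw [NT_succ, Finset.sum_range_succ', ih, Finset.mul_sum, sub_eq_add_neg, add_comm,
      ← Finset.sum_neg_distrib]
    congr 1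
    · apply Finset.sum_congr rfl
      intro j _
      rw [Nat.add_sub_add_right, Matrix.mul_smul, ← pow_succ', ← neg_smul]
      congr 1
      ring
    · simp

lemma NT_comm (i : ℕ) (M : Matrix (Fin n) (Fin n) R) : M * NT i M = NT i M * M := by
  rw [NT_eq_sum, Finset.mul_sum, Finset.sum_mul]
  apply Finset.sum_congr rfl
  intro j _
  rw [Matrix.mul_smul, Matrix.smul_mul, ← pow_succ', ← pow_succ]

lemma NT_conj (i : ℕ) (M U V : Matrix (Fin n) (Fin n) R) (h1 : U * V = 1) (h2 : V * U = 1) :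
    NT i (U * M * V) = U * NT i M * V ∧ HH i (U * M * V) = HH i M := by
  induction i with
  | zero => simp [NT_zero, HH_zero, h1]
  | succ i ih =>
    have h3 : U * M * V * (U * NT i M * V) = U * (M * NT i M) * V := by
      calc U * M * V * (U * NT i M * V) = U * M * (V * U) * NT i M * V := by
            simp only [Matrix.mul_assoc]
        _ = _ := by rw [h2]; simp only [Matrix.mul_assoc, Matrix.one_mul]
    have h4 : HH (i + 1) (U * M * V) = HH (i + 1) M := by
      rw [HH_succ, HH_succ, ih.1, h3, Matrix.trace_mul_comm, ← Matrix.mul_assoc, h2,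
        Matrix.one_mul]
    refine ⟨?_, h4⟩
    rw [NT_succ, NT_succ, h4, ih.1, h3, Matrix.mul_sub, Matrix.sub_mul]
    simp [h1]

lemma NT_map {S : Type*} [CommRing S] [Algebra ℝ S] (φ : R →ₐ[ℝ] S) (i : ℕ)
    (M : Matrix (Fin n) (Fin n) R) :
    NT i (M.map φ) = (NT i M).map φ ∧ HH i (M.map φ) = φ (HH i M) := by
  induction i with
  | zero => simp [NT_zero, HH_zero]
  | succ i ih =>
    have h3 : M.map φ * (NT i M).map φ = (M * NT i M).map φ := by
      rw [Matrix.map_mul]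
    have h4 : HH (i + 1) (M.map φ) = φ (HH (i + 1) M) := by
      rw [HH_succ, HH_succ, ih.1, h3, map_smul]
      congr 1
      generalize M * NT i M = N
      simp [Matrix.trace, map_sum]
    refine ⟨?_, h4⟩
    rw [NT_succ, NT_succ, h4, ih.1, h3]
    generalize M * NT i M = N
    ext a b
    by_cases hab : a = b
    · subst hab; simp
    · simp [hab]

section deriv
variable (D : Derivation ℝ R R)

def dM (M : Matrix (Fin n) (Fin n) R) : Matrix (Fin n) (Fin n) R := M.map D

lemma dM_mul (M N : Matrix (Fin n) (Fin n) R) : dM D (M * N) = dM D M * N + M * dM D N := by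
  ext i j
  simp only [dM, Matrix.map_apply, Matrix.mul_apply, Matrix.add_apply, map_sum, Derivation.leibniz,
    Finset.sum_add_distrib, smul_eq_mul]
  rw [add_comm]
  congr 1
  apply Finset.sum_congr rfl
  intro x _
  ring

lemma D_trace (M : Matrix (Fin n) (Fin n) R) : D M.trace = (dM D M).trace := by
  simp [Matrix.trace, dM, map_sum]

lemma D_trace_pow (M : Matrix (Fin n) (Fin n) R) (j : ℕ) :
    D (M ^ (j + 1)).trace = ((j : R) + 1) * (M ^ j * dM D M).trace := by
  rw [D_trace]
  have key : ∀ a b : ℕ, (M ^ a * dM D (M ^ (b + 1))).trace =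
      ((b : R) + 1) * (M ^ (a + b) * dM D M).trace := by
    intro a b
    induction b generalizing a with
    | zero => simp
    | succ b ih =>
      rw [pow_succ' M (b + 1), dM_mul, Matrix.mul_add, Matrix.trace_add, ← Matrix.mul_assoc (M ^ a) M,
        ← pow_succ, ih, ← Matrix.mul_assoc, Matrix.trace_mul_comm (M ^ a * dM D M),
        ← Matrix.mul_assoc, ← pow_add]
      have e1 : b + 1 + a = a + (b + 1) := by omega
      have e2 : a + 1 + b = a + (b + 1) := by omega
      rw [e1, e2]
      push_cast; ring
  simpa using key 0 j

open PowerSeries in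
def DPS (f : PowerSeries R) : PowerSeries R := PowerSeries.mk fun i => D (coeff i f)

open PowerSeries in
lemma DPS_mul (f g : PowerSeries R) : DPS D (f * g) = DPS D f * g + f * DPS D g := by
  ext i
  simp only [DPS, coeff_mk, coeff_mul, map_add, map_sum, Derivation.leibniz, smul_eq_mul,
    Finset.sum_add_distrib]
  rw [add_comm]
  congr 1
  apply Finset.sum_congr rfl
  intro x _
  ring

open PowerSeries in
lemma DPS_deriv (f : PowerSeries R) :
    DPS D (derivative R f) = derivative R (DPS D f) := by
  ext i
  simp only [DPS, coeff_mk, coeff_derivative, Derivation.leibniz, smul_eq_mul]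
  have : D ((i : R) + 1) = 0 := by
    have h2 : ((i : R) + 1) = algebraMap ℝ R ((i : ℝ) + 1) := by simp
    rw [h2, Derivation.map_algebraMap]
  rw [this]; ring

open PowerSeries in
lemma ode_unique (P z : PowerSeries R) (h : derivative R z = P * z) (h0 : coeff 0 z = 0) :
    z = 0 := by
  ext i
  rw [map_zero]
  induction i using Nat.strong_induction_on with
  | _ i ih =>
    cases i with
    | zero => exact h0
    | succ i =>
      have h1 := congrArg (coeff i) h
      rw [coeff_derivative, coeff_mul] at h1
      rw [Finset.sum_eq_zero] at h1
      · have hu : ((i : R) + 1) * algebraMap ℝ R (1 / ((i : ℝ) + 1)) = 1 := by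
          have h2 : ((i : R) + 1) = algebraMap ℝ R ((i : ℝ) + 1) := by simp
          rw [h2, ← map_mul, mul_one_div_cancel (by positivity), map_one]
        calc coeff (i + 1) z = coeff (i + 1) z * (((i : R) + 1) * algebraMap ℝ R (1 / ((i : ℝ) + 1))) := by
              rw [hu, mul_one]
          _ = 0 := by rw [← mul_assoc, h1, zero_mul]
      · intro x hx
        rw [ih x.2 (by have := Finset.HasAntidiagonal.mem_antidiagonal.1 hx; omega), mul_zero]

open PowerSeries in
/-- derivative of `σ_{i+1}` -/
lemma D_HH (i : ℕ) (M : Matrix (Fin n) (Fin n) R) :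
    D (HH (i + 1) M) = (NT i M * dM D M).trace := by
  set h : PowerSeries R := PowerSeries.mk fun i => HH i M with hh
  set P : PowerSeries R := PowerSeries.mk fun j => (-1) ^ j * (M ^ (j + 1)).trace with hP
  set x : PowerSeries R := PowerSeries.mk fun j => (-1) ^ j * (M ^ j * dM D M).trace with hx
  have e1 : derivative R h = P * h := by
    ext i
    rw [coeff_derivative, coeff_mul, Finset.Nat.sum_antidiagonal_eq_sum_range_succ_mk]
    simp only [hh, hP, coeff_mk]
    rw [mul_comm, ← trace_NT, NT_eq_sum, Finset.mul_sum, Matrix.trace_sum]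
    apply Finset.sum_congr rfl
    intro j _
    rw [Matrix.mul_smul, ← pow_succ', Matrix.trace_smul, smul_eq_mul]
    ring
  have e2 : DPS D P = derivative R (X * x) := by
    ext i
    rw [coeff_derivative, coeff_succ_X_mul]
    simp only [DPS, hP, hx, coeff_mk, Derivation.leibniz, smul_eq_mul, D_trace_pow]
    have : D ((-1 : R) ^ i) = 0 := by
      have h2 : ((-1 : R) ^ i) = algebraMap ℝ R ((-1) ^ i) := by simp
      rw [h2, Derivation.map_algebraMap]
    rw [this]; ring
  have e3 : DPS D h - h * (X * x) = 0 := by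
    apply ode_unique P
    · rw [map_sub, ← DPS_deriv, e1, DPS_mul, e2, Derivation.leibniz _ h, e1]
      simp only [smul_eq_mul]
      ring
    · have : coeff 0 (h * (X * x)) = 0 := by
        rw [← mul_assoc, mul_comm h X, mul_assoc]; simp
      rw [map_sub, this]
      simp [DPS, hh, HH_zero]
  have e4 := congrArg (coeff (i + 1)) (sub_eq_zero.1 e3)
  have e5 : h * (X * x) = X * (x * h) := by ring
  rw [e5, coeff_succ_X_mul, coeff_mul, Finset.Nat.sum_antidiagonal_eq_sum_range_succ_mk] at e4
  simp only [DPS, hh, hx, coeff_mk] at e4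
  rw [e4, NT_eq_sum, Finset.sum_mul, Matrix.trace_sum]
  apply Finset.sum_congr rfl
  intro j _
  rw [Matrix.smul_mul, Matrix.trace_smul, smul_eq_mul]
  ring

end deriv

/-- divergence-free Newton tensors -/
lemma NT_div_free (d : Fin n → Derivation ℝ R R) (M : Matrix (Fin n) (Fin n) R)
    (hM : ∀ i j, M i j = M j i) (hd : ∀ i j l, d i (M j l) = d j (M i l)) (i : ℕ) (l : Fin n) :
    ∑ j, d j (NT i M j l) = 0 := by
  induction i generalizing l with
  | zero =>
    apply Finset.sum_eq_zero
    intro j _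
    rw [NT_zero, Matrix.one_apply]
    split_ifs <;> simp
  | succ i ih =>
    have h1 : ∀ j, d j (NT (i + 1) M j l) = (if j = l then d j (HH (i + 1) M) else 0)
        - ∑ s, (NT i M j s * d j (M s l) + M s l * d j (NT i M j s)) := by
      intro j
      rw [NT_succ, NT_comm, Matrix.sub_apply, map_sub, Matrix.mul_apply, map_sum]
      congr 1
      · rw [Matrix.smul_apply, Matrix.one_apply]
        split_ifs <;> simp
      · apply Finset.sum_congr rfl
        intro s _
        rw [Derivation.leibniz]; simp
    rw [Finset.sum_congr rfl fun j _ => h1 j, Finset.sum_sub_distrib,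
      Finset.sum_ite_eq' Finset.univ l, if_pos (Finset.mem_univ _), D_HH]
    simp only [Finset.sum_add_distrib]
    have h2 : ∑ j, ∑ s, M s l * d j (NT i M j s) = 0 := by
      rw [Finset.sum_comm]
      apply Finset.sum_eq_zero
      intro s _
      rw [← Finset.mul_sum, ih, mul_zero]
    rw [h2, add_zero, sub_eq_zero, Matrix.trace]
    apply Finset.sum_congr rfl
    intro j _
    rw [Matrix.diag_apply, Matrix.mul_apply]
    apply Finset.sum_congr rfl
    intro s _
    congr 1
    simp only [dM, Matrix.map_apply]
    rw [hM s j, hd, hM l s]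

/-- the coefficient `G x l = (x+1)...(x+l) / (2^l l!)` -/
def Gc (x : ℝ) (l : ℕ) : ℝ := poch x l / (2 ^ l * Nat.factorial l)

lemma poch_succ' (x : ℝ) (l : ℕ) : poch x (l + 1) = (x + 1) * poch (x + 1) l := by
  unfold poch
  rw [Finset.prod_range_succ', mul_comm]
  congr 1
  · simp
  · apply Finset.prod_congr rfl
    intro i _; push_cast; ring

lemma poch_succ (x : ℝ) (l : ℕ) : poch x (l + 1) = poch x l * (x + l + 1) := by
  unfold poch
  rw [Finset.prod_range_succ]

/-- `e_i = G (α+i) (k-i)` -/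
def ec (k : ℕ) (α : ℝ) (i : ℕ) : ℝ := Gc (α + i) (k - i)

lemma ec_rec (k : ℕ) (α : ℝ) (i : ℕ) (hi : i < k) :
    ec k α (i + 1) * (α + i + 1) = 2 * ((k : ℝ) - i) * ec k α i := by
  obtain ⟨m, rfl⟩ := Nat.exists_eq_add_of_lt hi
  unfold ec Gc
  have e1 : i + m + 1 - (i + 1) = m := by omega
  have e2 : i + m + 1 - i = m + 1 := by omega
  rw [e1, e2, poch_succ', Nat.factorial_succ]
  push_cast
  rw [← add_assoc]
  field_simp
  ring

open Matrix in
/-- **The divergence identity**. -/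
lemma div_identity (d : Fin n → Derivation ℝ R R)
    (hcomm : ∀ i j (f : R), d i (d j f) = d j (d i f)) (w : R) (k : ℕ) (α : ℝ)
    (W : ℕ → R) (hW : ∀ i j, d j (W (i + 1)) = algebraMap ℝ R (α + i + 1) * W i * d j w) :
    ∑ j, d j (∑ i ∈ Finset.range k, algebraMap ℝ R (ec k α (i + 1)) * W (i + 1) *
        (∑ l, d l w ^ 2) ^ (k - 1 - i) *
        (NT i (Matrix.of fun a b => d a (d b w)) *ᵥ (fun l => d l w)) j) =
      ∑ i ∈ Finset.range (k + 1), algebraMap ℝ R ((2 * (k : ℝ) - i) * ec k α i) * W i *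
        (∑ l, d l w ^ 2) ^ (k - i) * HH i (Matrix.of fun a b => d a (d b w)) := by
  set M : Matrix (Fin n) (Fin n) R := Matrix.of fun a b => d a (d b w) with hMdef
  set g : Fin n → R := fun l => d l w with hg
  set p : R := ∑ l, d l w ^ 2 with hp
  have hMs : ∀ i j, M i j = M j i := fun i j => hcomm i j w
  have hMd : ∀ i j l, d i (M j l) = d j (M i l) := fun i j l => hcomm i j _
  have hdp : ∀ j, d j p = 2 * (M *ᵥ g) j := by
    intro j
    rw [hp, map_sum, Matrix.mulVec, dotProduct, Finset.mul_sum]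
    apply Finset.sum_congr rfl
    intro l _
    rw [Derivation.leibniz_pow]
    simp [hMdef, hg]; ring
  set τ : ℕ → R := fun i => g ⬝ᵥ (NT i M *ᵥ g) with hτ
  have hp0 : τ 0 = p := by
    simp only [hτ, NT_zero, one_mulVec, hp, hg, dotProduct, sq]
  -- divergence of `T g`
  have h1 : ∀ i, ∑ j, d j ((NT i M *ᵥ g) j) = ((i : R) + 1) * HH (i + 1) M := by
    intro i
    have : ∀ j, d j ((NT i M *ᵥ g) j) = ∑ l, (NT i M j l * M l j + g l * d j (NT i M j l)) := by
      intro j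
      rw [Matrix.mulVec, dotProduct, map_sum]
      apply Finset.sum_congr rfl
      intro l _
      rw [Derivation.leibniz, hMs l j]; rfl
    rw [Finset.sum_congr rfl fun j _ => this j]
    simp only [Finset.sum_add_distrib]
    have h2 : ∑ j, ∑ l, g l * d j (NT i M j l) = 0 := by
      rw [Finset.sum_comm]
      apply Finset.sum_eq_zero
      intro s _
      rw [← Finset.mul_sum, NT_div_free d M hMs hMd, mul_zero]
    rw [h2, add_zero, ← trace_NT, NT_comm, Matrix.trace]
    simp [Matrix.mul_apply]
  have h2 : ∀ i, (M *ᵥ g) ⬝ᵥ (NT i M *ᵥ g) = HH (i + 1) M * p - τ (i + 1) := by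
    intro i
    have hMt : Mᵀ = M := by ext a b; exact hMs b a
    have : (M *ᵥ g) ⬝ᵥ (NT i M *ᵥ g) = g ⬝ᵥ ((M * NT i M) *ᵥ g) := by
      rw [← mulVec_mulVec, dotProduct_mulVec g M, ← mulVec_transpose, hMt]
    rw [this]
    have h3 : M * NT i M = HH (i + 1) M • (1 : Matrix (Fin n) (Fin n) R) - NT (i + 1) M := by
      rw [NT_succ]; abel
    rw [h3, sub_mulVec, dotProduct_sub, smul_mulVec, one_mulVec, dotProduct_smul, ← hp0]
    simp [hτ, NT_zero]
  have hterm : ∀ i ∈ Finset.range k,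
      ∑ j, d j (algebraMap ℝ R (ec k α (i + 1)) * W (i + 1) * p ^ (k - 1 - i) *
        (NT i M *ᵥ g) j) =
      algebraMap ℝ R ((2 * (k : ℝ) - ((i + 1 : ℕ) : ℝ)) * ec k α (i + 1)) * W (i + 1)
        * p ^ (k - (i + 1)) * HH (i + 1) M
      + (algebraMap ℝ R (2 * ((k : ℝ) - i) * ec k α i) * W i * p ^ (k - 1 - i) * τ i
      - algebraMap ℝ R (2 * ((k : ℝ) - ((i + 1 : ℕ) : ℝ)) * ec k α (i + 1)) * W (i + 1) *
          p ^ (k - 1 - (i + 1)) * τ (i + 1)) := by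
    intro i hi
    have hik : i < k := by simpa using hi
    obtain ⟨m, hm⟩ := Nat.exists_eq_add_of_lt hik
    have hmk : k - 1 - i = m := by omega
    have hmk2 : k - (i + 1) = m := by omega
    have hmk3 : k - 1 - (i + 1) = m - 1 := by omega
    rw [hmk, hmk2, hmk3, ← ec_rec k α i hik]
    have hkr : (k : ℝ) = i + m + 1 := by rw [hm]; push_cast; ring
    have hj : ∀ j, d j (algebraMap ℝ R (ec k α (i + 1)) * W (i + 1) * p ^ m * (NT i M *ᵥ g) j) =
        algebraMap ℝ R (ec k α (i + 1)) * W (i + 1) * p ^ m * d j ((NT i M *ᵥ g) j)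
        + algebraMap ℝ R (ec k α (i + 1)) * W (i + 1) * (m * p ^ (m - 1) * 2) *
          ((M *ᵥ g) j * (NT i M *ᵥ g) j)
        + algebraMap ℝ R (ec k α (i + 1)) * p ^ m * (algebraMap ℝ R (α + i + 1) * W i) *
          (g j * (NT i M *ᵥ g) j) := by
      intro j
      simp only [Derivation.leibniz, Derivation.leibniz_pow, hdp, hW, Derivation.map_algebraMap,
        smul_eq_mul, nsmul_eq_mul, hg]
      ring
    rw [Finset.sum_congr rfl fun j _ => hj j, Finset.sum_add_distrib, Finset.sum_add_distrib,
      ← Finset.mul_sum, ← Finset.mul_sum, ← Finset.mul_sum, h1]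
    have e1 : ∑ j, (M *ᵥ g) j * (NT i M *ᵥ g) j = HH (i + 1) M * p - τ (i + 1) := h2 i
    have e2 : ∑ j, g j * (NT i M *ᵥ g) j = τ i := rfl
    rw [e1, e2, hkr]
    have e3 : (m : R) * p ^ (m - 1) * p = m * p ^ m := by
      cases m with
      | zero => simp
      | succ m => rw [Nat.add_sub_cancel, mul_assoc, pow_succ]
    simp only [map_mul, map_add, map_sub, map_natCast, map_one, map_ofNat, Nat.cast_add,
      Nat.cast_one]
    linear_combination (2 * algebraMap ℝ R (ec k α (i + 1)) * W (i + 1) * HH (i + 1) M) * e3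
  simp only [map_sum] at hterm ⊢
  rw [Finset.sum_comm, Finset.sum_congr rfl hterm, Finset.sum_add_distrib,
    Finset.sum_range_sub' (fun i => algebraMap ℝ R (2 * ((k : ℝ) - (i : ℕ)) * ec k α i) * W i *
          p ^ (k - 1 - i) * τ i), Finset.sum_range_succ' _ k]
  congr 1
  rw [hp0, HH_zero]
  cases k with
  | zero => simp
  | succ k =>
    simp only [map_mul, map_natCast, map_ofNat, CharP.cast_eq_zero, sub_zero, sub_self]
    simp only [Nat.add_sub_cancel, Nat.sub_zero, pow_succ]
    simp
    ring

end FL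

/-! ## Part C: symmetric matrices -/

lemma sum_mul_es_erase' {ι : Type*} [DecidableEq ι] (s : Finset ι) (k : ℕ) (f : ι → ℝ) :
    ∑ i ∈ s, f i * es (s.erase i) k f = (k + 1) * es s (k + 1) f := by
  convert sum_mul_es_erase s k f

lemma es_erase' {ι : Type*} [DecidableEq ι] {s : Finset ι} {a : ι} (ha : a ∈ s) (k : ℕ)
    (f : ι → ℝ) : es s (k + 1) f = es (s.erase a) (k + 1) f + f a * es (s.erase a) k f := by
  convert es_erase ha k f

lemma NT_diag {n : ℕ} (i : ℕ) (d : Fin n → ℝ) :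
    NT i (Matrix.diagonal d) = Matrix.diagonal (fun j => es (Finset.univ.erase j) i d) ∧
    HH i (Matrix.diagonal d) = es Finset.univ i d := by
  induction i with
  | zero => simp [NT_zero, HH_zero, es_zero]
  | succ i ih =>
    have h4 : HH (i + 1) (Matrix.diagonal d) = es Finset.univ (i + 1) d := by
      rw [HH_succ, ih.1, Matrix.diagonal_mul_diagonal, Matrix.trace_diagonal, sum_mul_es_erase',
        smul_eq_mul]
      field_simp
    refine ⟨?_, h4⟩
    rw [NT_succ, h4, ih.1, Matrix.diagonal_mul_diagonal]
    ext a b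
    by_cases hab : a = b
    · subst hab
      simp [es_erase' (Finset.mem_univ a) i d]
    · simp [hab]

lemma spectral {n : ℕ} (M : Matrix (Fin n) (Fin n) ℝ) (hM : M.IsHermitian) :
    ∃ U : Matrix (Fin n) (Fin n) ℝ, U * U.transpose = 1 ∧ U.transpose * U = 1 ∧
      M = U * Matrix.diagonal (eigs M) * U.transpose := by
  refine ⟨hM.eigenvectorUnitary, ?_, ?_, ?_⟩
  · have := Unitary.coe_mul_star_self hM.eigenvectorUnitary
    simpa [Matrix.star_eq_conjTranspose] using this
  · have := Unitary.coe_star_mul_self hM.eigenvectorUnitary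
    simpa [Matrix.star_eq_conjTranspose] using this
  · have := hM.spectral_theorem
    rw [Unitary.conjStarAlgAut_apply] at this
    have h2 : eigs M = hM.eigenvalues := by unfold eigs; rw [dif_pos hM]
    rw [h2]
    simpa [Matrix.star_eq_conjTranspose, Function.comp_def] using this

lemma HH_of_diag {n : ℕ} (i : ℕ) (U : Matrix (Fin n) (Fin n) ℝ) (d : Fin n → ℝ)
    (h1 : U * U.transpose = 1) (h2 : U.transpose * U = 1) :
    HH i (U * Matrix.diagonal d * U.transpose) = es Finset.univ i d := by
  rw [(NT_conj i _ U U.transpose h1 h2).2, (NT_diag i d).2]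

lemma Sk_eq {n : ℕ} (i : ℕ) (M : Matrix (Fin n) (Fin n) ℝ) (hM : M.IsHermitian) :
    Sk n i M = HH i M := by
  obtain ⟨U, h1, h2, h3⟩ := spectral M hM
  conv_rhs => rw [h3, HH_of_diag i U _ h1 h2]
  rfl

/-- matrix cone -/
def CM {n : ℕ} (k : ℕ) (M : Matrix (Fin n) (Fin n) ℝ) : Prop :=
  M.IsHermitian ∧ ∀ j, j ≤ k → 0 ≤ HH j M

lemma CM_eigs {n k : ℕ} {M : Matrix (Fin n) (Fin n) ℝ} (hM : CM k M) :
    CG Finset.univ k (eigs M) := by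
  intro j hj
  have := hM.2 j hj
  rw [← Sk_eq j M hM.1] at this
  exact this

lemma CM_of_diag {n k : ℕ} (U : Matrix (Fin n) (Fin n) ℝ) (d : Fin n → ℝ)
    (h1 : U * U.transpose = 1) (h2 : U.transpose * U = 1) (hd : CG Finset.univ k d) :
    CM k (U * Matrix.diagonal d * U.transpose) := by
  refine ⟨?_, ?_⟩
  · rw [Matrix.IsHermitian, Matrix.conjTranspose_eq_transpose_of_trivial]
    simp [Matrix.transpose_mul, Matrix.mul_assoc]
  · intro j hj
    rw [HH_of_diag j U d h1 h2]
    exact hd j hj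

/-- Schur-Horn for the cone -/
lemma CM_diag_conj {n k : ℕ} (hk : k ≤ n) {M : Matrix (Fin n) (Fin n) ℝ} (hM : CM k M)
    (U : Matrix (Fin n) (Fin n) ℝ) (h1 : U * U.transpose = 1) (h2 : U.transpose * U = 1) :
    CG Finset.univ k (fun i => (U.transpose * M * U) i i) := by
  obtain ⟨V, g1, g2, g3⟩ := spectral M hM.1
  set Q := U.transpose * V with hQ
  have q1 : Q * Q.transpose = 1 := by
    rw [hQ, Matrix.transpose_mul, Matrix.transpose_transpose, Matrix.mul_assoc,
      ← Matrix.mul_assoc V, g1, Matrix.one_mul, h2]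
  have q2 : Q.transpose * Q = 1 := by
    rw [hQ, Matrix.transpose_mul, Matrix.transpose_transpose, Matrix.mul_assoc,
      ← Matrix.mul_assoc U, h1, Matrix.one_mul, g2]
  have hds : (Matrix.of fun i j => Q i j ^ 2) ∈ doublyStochastic ℝ (Fin n) := by
    rw [mem_doublyStochastic_iff_sum]
    refine ⟨fun i j => by simp [sq_nonneg], fun i => ?_, fun j => ?_⟩
    · have := congrFun (congrFun q1 i) i
      simpa [Matrix.mul_apply, sq] using this
    · have := congrFun (congrFun q2 j) j
      simpa [Matrix.mul_apply, sq] using this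
  have h3 := CG_ds hk (CM_eigs hM) hds
  convert h3 using 1
  ext i
  have h4 : U.transpose * M * U = Q * Matrix.diagonal (eigs M) * Q.transpose := by
    conv_lhs => rw [g3]
    rw [hQ, Matrix.transpose_mul, Matrix.transpose_transpose]
    simp only [Matrix.mul_assoc]
  rw [h4, Matrix.mul_apply, Matrix.mulVec, dotProduct]
  apply Finset.sum_congr rfl
  intro j _
  rw [Matrix.mul_diagonal, Matrix.transpose_apply, Matrix.of_apply]
  ring

lemma CM_add {n k : ℕ} (hk : k ≤ n) {M N : Matrix (Fin n) (Fin n) ℝ} (hM : CM k M)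
    (hN : CM k N) : CM k (M + N) := by
  have hs : (M + N).IsHermitian := hM.1.add hN.1
  obtain ⟨U, h1, h2, h3⟩ := spectral _ hs
  have h4 : ∀ i, eigs (M + N) i = (U.transpose * M * U) i i + (U.transpose * N * U) i i := by
    intro i
    rw [← Matrix.add_apply, ← Matrix.add_mul, ← Matrix.mul_add]
    conv_rhs => rw [h3]
    have : U.transpose * (U * Matrix.diagonal (eigs (M + N)) * U.transpose) * U =
        (U.transpose * U) * Matrix.diagonal (eigs (M + N)) * (U.transpose * U) := by
      simp only [Matrix.mul_assoc]
    rw [this, h2]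
    simp
  rw [h3]
  apply CM_of_diag U _ h1 h2
  rw [funext h4]
  exact CG_add (by simpa using hk) (CM_diag_conj hk hM U h1 h2) (CM_diag_conj hk hN U h1 h2)

lemma HH_smul {n : ℕ} (i : ℕ) (M : Matrix (Fin n) (Fin n) ℝ) (c : ℝ) :
    NT i (c • M) = c ^ i • NT i M ∧ HH i (c • M) = c ^ i * HH i M := by
  induction i with
  | zero => simp [NT_zero, HH_zero]
  | succ i ih =>
    have h0 : (c • M) * NT i (c • M) = c ^ (i + 1) • (M * NT i M) := by
      rw [ih.1, Matrix.smul_mul, Matrix.mul_smul, smul_smul, pow_succ']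
    have h1 : HH (i + 1) (c • M) = c ^ (i + 1) * HH (i + 1) M := by
      rw [HH_succ, HH_succ, h0, Matrix.trace_smul]
      simp only [smul_eq_mul]; ring
    refine ⟨?_, h1⟩
    rw [NT_succ, NT_succ, h1, h0, smul_sub, smul_smul]

lemma CM_smul {n k : ℕ} {M : Matrix (Fin n) (Fin n) ℝ} (hM : CM k M) {c : ℝ} (hc : 0 ≤ c) :
    CM k (c • M) := by
  refine ⟨?_, ?_⟩
  · have := hM.1
    rw [Matrix.IsHermitian, Matrix.conjTranspose_eq_transpose_of_trivial] at this ⊢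
    rw [Matrix.transpose_smul, this]
  · intro j hj
    rw [(HH_smul j M c).2]
    exact mul_nonneg (pow_nonneg hc _) (hM.2 j hj)

lemma CM_psd {n k : ℕ} {M : Matrix (Fin n) (Fin n) ℝ} (hM : M.PosSemidef) : CM k M := by
  have hs := hM.1
  refine ⟨hs, fun j hj => ?_⟩
  rw [← Sk_eq j M hs]
  have h2 : eigs M = hs.eigenvalues := by unfold eigs; rw [dif_pos hs]
  have : CG Finset.univ k (eigs M) := by
    apply CG_of_nonneg
    intro i
    rw [h2]
    exact hM.eigenvalues_nonneg i
  exact this j hj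

lemma HH_continuous {n : ℕ} (i : ℕ) :
    Continuous (NT i : Matrix (Fin n) (Fin n) ℝ → Matrix (Fin n) (Fin n) ℝ) ∧
    Continuous (HH i : Matrix (Fin n) (Fin n) ℝ → ℝ) := by
  induction i with
  | zero => exact ⟨continuous_const, continuous_const⟩
  | succ i ih =>
    have h0 : Continuous fun M : Matrix (Fin n) (Fin n) ℝ => M * NT i M :=
      continuous_id.matrix_mul ih.1
    have h1 : Continuous (HH (i + 1) : Matrix (Fin n) (Fin n) ℝ → ℝ) := by
      have : (HH (i + 1) : Matrix (Fin n) (Fin n) ℝ → ℝ) = fun M =>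
        (1 / ((i : ℝ) + 1)) • (M * NT i M).trace := rfl
      rw [this]
      simp only [smul_eq_mul]
      exact continuous_const.mul h0.matrix_trace
    refine ⟨?_, h1⟩
    have : (NT (i + 1) : Matrix (Fin n) (Fin n) ℝ → Matrix (Fin n) (Fin n) ℝ) = fun M =>
      HH (i + 1) M • (1 : Matrix (Fin n) (Fin n) ℝ) - M * NT i M := rfl
    rw [this]
    exact (h1.smul continuous_const).sub h0

lemma HH_gt {n : ℕ} (i : ℕ) (hi : n < i) (M : Matrix (Fin n) (Fin n) ℝ) (hM : M.IsHermitian) :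
    HH i M = 0 := by
  rw [← Sk_eq i M hM]
  exact es_eq_zero _ _ (by simpa using hi) _

section conv
open PowerSeries

lemma Gc_step (x : ℝ) (l : ℕ) : Gc x (l + 1) - (1 / 2) * Gc x l = Gc (x - 1) (l + 1) := by
  unfold Gc
  rw [poch_succ', poch_succ' (x - 1), Nat.factorial_succ]
  have e : x - 1 + 1 = x := by ring
  have h1 : (x + 1) * poch (x + 1) l = poch x l * (x + l + 1) := by
    rw [← poch_succ', poch_succ]
  rw [e, h1]
  push_cast
  field_simp
  ring

def gser (p x : ℝ) : PowerSeries ℝ := PowerSeries.mk fun l => Gc x l * p ^ l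

lemma gser_step (p x : ℝ) : (1 - C (p / 2) * X) * gser p x = gser p (x - 1) := by
  ext l
  rw [sub_mul, one_mul, mul_assoc, map_sub, coeff_C_mul]
  cases l with
  | zero => simp [gser, Gc, poch]
  | succ l =>
    rw [coeff_succ_X_mul]
    simp only [gser, coeff_mk]
    rw [← Gc_step]; ring

lemma gser_pow (p x : ℝ) (m : ℕ) : (1 - C (p / 2) * X) ^ m * gser p x = gser p (x - m) := by
  induction m with
  | zero => simp
  | succ m ih =>
    rw [pow_succ', mul_assoc, ih, gser_step]
    congr 1; push_cast; ring

lemma prod_one_add_X {n : ℕ} (d : Fin n → ℝ) :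
    ∏ i, ((1 : PowerSeries ℝ) + X * C (d i)) = PowerSeries.mk fun j => es Finset.univ j d := by
  have := prod_add_mul_es (R := PowerSeries ℝ) Finset.univ 1 X d
  simp only [PowerSeries.algebraMap_apply, Algebra.algebraMap_self, RingHom.id_apply] at this
  rw [this]
  ext j
  simp only [map_sum, one_pow, one_mul, coeff_mul_C, coeff_X_pow, coeff_mk]
  by_cases hj : j < n + 1
  · rw [Finset.sum_eq_single j]
    · simp
    · intro b _ hb; simp [hb.symm]
    · intro h; simp at h; omega
  · rw [es_eq_zero _ _ (by simp; omega)]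
    apply Finset.sum_eq_zero
    intro b hb
    rw [if_neg (by simp at hb; omega)]; simp

/-- conversion, generating function form -/
lemma conv_aux {n : ℕ} (D : Matrix (Fin n) (Fin n) ℝ) (hD : D.IsHermitian) (w p α : ℝ) (K : ℕ)
    (hK : K ≤ n) :
    ∑ l ∈ Finset.range (K + 1), Gc (α + n) l * p ^ l * HH (K - l) (w • D - (p / 2) • 1) =
      ∑ i ∈ Finset.range (K + 1), Gc (α + i) (K - i) * p ^ (K - i) * w ^ i * HH i D := by
  obtain ⟨U, h1, h2, h3⟩ := spectral D hD
  set μ := eigs D with hμ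
  have hA : w • D - (p / 2) • (1 : Matrix (Fin n) (Fin n) ℝ) =
      U * Matrix.diagonal (fun i => w * μ i - p / 2) * U.transpose := by
    have e1 : Matrix.diagonal (fun i => w * μ i - p / 2) =
        w • Matrix.diagonal μ - (p / 2) • (1 : Matrix (Fin n) (Fin n) ℝ) := by
      ext a b
      by_cases hab : a = b
      · subst hab; simp
      · simp [hab]
    rw [e1, Matrix.mul_sub, Matrix.sub_mul, Matrix.mul_smul, Matrix.smul_mul, ← h3,
      Matrix.mul_smul, Matrix.smul_mul, Matrix.mul_one, h1]
  have hH : ∀ j, HH j (w • D - (p / 2) • 1) = es Finset.univ j (fun i => w * μ i - p / 2) := by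
    intro j
    rw [hA, HH_of_diag j U _ h1 h2]
  have hH' : ∀ j, HH j D = es Finset.univ j μ := by
    intro j
    conv_lhs => rw [h3, HH_of_diag j U _ h1 h2]
  have e2 : ∏ i, ((1 : PowerSeries ℝ) + X * C (w * μ i - p / 2)) =
      ∏ i, ((1 - C (p / 2) * X) + (X * C w) * C (μ i)) := by
    apply Finset.prod_congr rfl
    intro i _
    simp only [map_sub, map_mul]; ring
  have e3 := prod_add_mul_es (R := PowerSeries ℝ) Finset.univ (1 - C (p / 2) * X) (X * C w) μ
  simp only [PowerSeries.algebraMap_apply, Algebra.algebraMap_self, RingHom.id_apply, Finset.card_univ,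
    Fintype.card_fin] at e3
  rw [prod_one_add_X, e3] at e2
  have e4 := congrArg (fun f => coeff K (gser p (α + n) * f)) e2
  simp only [coeff_mul, Finset.Nat.sum_antidiagonal_eq_sum_range_succ_mk, coeff_mk, gser] at e4
  simp only [hH, hH']
  rw [e4]
  have e5 := coeff_mul K (gser p (α + n)) (∑ j ∈ Finset.range (n + 1),
    (1 - C (p / 2) * X) ^ (n - j) * (X * C w) ^ j * C (es Finset.univ j μ))
  simp only [Finset.Nat.sum_antidiagonal_eq_sum_range_succ_mk, coeff_mk, gser] at e5
  rw [← e5, Finset.mul_sum, map_sum]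
  have e6 : ∀ j ∈ Finset.range (n + 1), coeff K (gser p (α + n) *
      ((1 - C (p / 2) * X) ^ (n - j) * (X * C w) ^ j * C (es Finset.univ j μ))) =
      if j ≤ K then Gc (α + j) (K - j) * p ^ (K - j) * w ^ j * es Finset.univ j μ else 0 := by
    intro j hj
    have hj' : j ≤ n := by simp at hj; omega
    have e7 : gser p (α + n) * ((1 - C (p / 2) * X) ^ (n - j) * (X * C w) ^ j *
        C (es Finset.univ j μ)) =
        ((1 - C (p / 2) * X) ^ (n - j) * gser p (α + n)) * C (w ^ j * es Finset.univ j μ)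
          * X ^ j := by
      rw [mul_pow, map_mul, map_pow]; ring
    rw [e7, gser_pow, coeff_mul_X_pow', Nat.cast_sub hj']
    split_ifs
    · rw [coeff_mul_C]
      simp only [gser, coeff_mk]
      have : α + n - ((n : ℝ) - j) = α + j := by ring
      rw [this]; ring
    · rfl
  have e8 : gser p (α + n) = PowerSeries.mk (fun l => Gc (α + n) l * p ^ l) := rfl
  rw [← e8, Finset.sum_congr rfl e6, ← Finset.sum_filter]
  apply Finset.sum_congr
  · ext j; simp; omega
  · intro j _; rfl

end conv

/-- `b_l = k g_l + (α+k)/2 g_{l-1}` -/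
lemma bcoef_succ (n k : ℕ) (α : ℝ) (l : ℕ) :
    bcoef n k α (l + 1) = k * Gc (α + n) (l + 1) + (α + k) / 2 * Gc (α + n) l := by
  simp only [bcoef, Gc]
  rw [poch_succ, Nat.factorial_succ]
  push_cast
  field_simp
  ring

lemma bcoef_zero (n k : ℕ) (α : ℝ) : bcoef n k α 0 = k * Gc (α + n) 0 := by
  simp [bcoef, Gc, poch]

lemma poch_nonneg {x : ℝ} (hx : 0 ≤ x) (l : ℕ) : 0 ≤ poch x l := by
  unfold poch
  exact Finset.prod_nonneg fun i _ => by positivity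

lemma bcoef_nonneg (n k : ℕ) {α : ℝ} (hα : 0 ≤ α) (l : ℕ) : 0 ≤ bcoef n k α l := by
  cases l with
  | zero => simp [bcoef]
  | succ l =>
    have := poch_nonneg (x := α + n) (by positivity) l
    simp only [bcoef]
    positivity

/-- the algebraic conversion of the integrand -/
lemma conv_main {n : ℕ} (D : Matrix (Fin n) (Fin n) ℝ) (hD : D.IsHermitian) (w p α : ℝ) (k : ℕ)
    (hk1 : 1 ≤ k) (hk : k ≤ n) :
    ∑ l ∈ Finset.range (k + 1), bcoef n k α l * p ^ l * HH (k - l) (w • D - (p / 2) • 1) =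
      ∑ i ∈ Finset.range (k + 1), ((2 * (k : ℝ) - i) * ec k α i) * w ^ i * p ^ (k - i)
        * HH i D := by
  obtain ⟨m, rfl⟩ : ∃ m, k = m + 1 := ⟨k - 1, by omega⟩
  have h1 := conv_aux D hD w p α (m + 1) hk
  have h2 := conv_aux D hD w p α m (by omega)
  set A := w • D - (p / 2) • (1 : Matrix (Fin n) (Fin n) ℝ) with hA
  have e1 : ∑ l ∈ Finset.range (m + 1 + 1), bcoef n (m + 1) α l * p ^ l * HH (m + 1 - l) A =
      ((m : ℝ) + 1) * ∑ l ∈ Finset.range (m + 1 + 1), Gc (α + n) l * p ^ l * HH (m + 1 - l) A +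
      (α + (m + 1)) / 2 * p * ∑ l ∈ Finset.range (m + 1), Gc (α + n) l * p ^ l * HH (m - l) A := by
    rw [Finset.sum_range_succ' _ (m + 1), Finset.sum_range_succ' _ (m + 1), mul_add, Finset.mul_sum,
      Finset.mul_sum, bcoef_zero]
    rw [add_right_comm, ← Finset.sum_add_distrib]
    congr 1
    · apply Finset.sum_congr rfl
      intro l _
      rw [bcoef_succ, Nat.add_sub_add_right]
      push_cast
      ring
    · push_cast; ring
  rw [e1, h1, h2, Finset.sum_range_succ _ (m + 1), Finset.sum_range_succ _ (m + 1), mul_add,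
    add_right_comm]
  congr 1
  · rw [Finset.mul_sum, Finset.mul_sum, ← Finset.sum_add_distrib]
    apply Finset.sum_congr rfl
    intro i hi
    have hi' : i ≤ m := by simp at hi; omega
    obtain ⟨r, rfl⟩ := Nat.exists_eq_add_of_le hi'
    have a1 : i + r + 1 - i = r + 1 := by omega
    have a2 : i + r - i = r := by omega
    unfold ec
    rw [a1, a2]
    have a3 : (α + ((i + r : ℕ) + 1 : ℝ)) / 2 * Gc (α + i) r = (r + 1) * Gc (α + i) (r + 1) := by
      unfold Gc
      rw [poch_succ, Nat.factorial_succ]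
      push_cast
      field_simp
      ring
    have a4 : ((2 * ((i + r + 1 : ℕ) : ℝ) - i)) = ((i + r : ℕ) : ℝ) + 1 + (r + 1) := by
      push_cast; ring
    rw [a4, pow_succ]
    linear_combination (p ^ r * p * w ^ i * HH i D) * a3
  · unfold ec
    push_cast
    ring

/-! ## Part D: the null Lagrangian property -/

section smooth
open scoped ContDiff

/-- the integrand as a function of the 2-jet -/
def FF {n : ℕ} (k : ℕ) (α : ℝ) (w : ℝ) (p : Fin n → ℝ) (M : Matrix (Fin n) (Fin n) ℝ) : ℝ :=
  ∑ i ∈ Finset.range (k + 1), ((2 * (k : ℝ) - i) * ec k α i) * w ^ (α + i) *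
    (∑ l, p l ^ 2) ^ (k - i) * HH i M

/-- the vector field as a function of the 2-jet -/
def XX {n : ℕ} (k : ℕ) (α : ℝ) (w : ℝ) (p : Fin n → ℝ) (M : Matrix (Fin n) (Fin n) ℝ)
    (j : Fin n) : ℝ :=
  ∑ i ∈ Finset.range k, ec k α (i + 1) * w ^ (α + i + 1) *
    (∑ l, p l ^ 2) ^ (k - 1 - i) * (NT i M).mulVec p j

/-- smooth functions -/
def SR (n : ℕ) : Subalgebra ℝ (E n → ℝ) where
  carrier := {f | ContDiff ℝ ∞ f}
  mul_mem' := by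
    intro a b ha hb
    simp only [Set.mem_ofPred_eq] at *
    exact ContDiff.mul ha hb
  add_mem' := by
    intro a b ha hb
    simp only [Set.mem_ofPred_eq] at *
    exact ContDiff.add ha hb
  algebraMap_mem' := by
    intro r
    simp only [Set.mem_ofPred_eq]
    exact contDiff_const (c := r)

lemma SR_smooth {n : ℕ} (f : SR n) : ContDiff ℝ ∞ (f : E n → ℝ) := f.2

lemma SR_diff {n : ℕ} (f : SR n) (x : E n) : DifferentiableAt ℝ (f : E n → ℝ) x :=
  (SR_smooth f).differentiable (by simp) x

lemma pd_smooth {n : ℕ} {f : E n → ℝ} (hf : ContDiff ℝ ∞ f) (j : Fin n) :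
    ContDiff ℝ ∞ (fun x => pd f j x) := by
  unfold pd
  exact (hf.fderiv_right (m := ∞) (by simp)).clm_apply contDiff_const

/-- partial derivative as a derivation -/
def Dv {n : ℕ} (j : Fin n) : Derivation ℝ (SR n) (SR n) :=
  Derivation.mk'
    { toFun := fun f => ⟨fun x => pd (f : E n → ℝ) j x, pd_smooth (SR_smooth f) j⟩
      map_add' := by
        intro f g
        apply Subtype.ext
        funext x
        simp only [pd, Subalgebra.coe_add, Pi.add_apply]
        rw [fderiv_add (SR_diff f x) (SR_diff g x)]
        rfl
      map_smul' := by
        intro c f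
        apply Subtype.ext
        funext x
        simp only [pd, Subalgebra.coe_smul, Pi.smul_apply]
        rw [fderiv_const_smul (SR_diff f x)]
        rfl }
    (by
      intro f g
      apply Subtype.ext
      funext x
      have := fderiv_mul (SR_diff f x) (SR_diff g x)
      simp only [LinearMap.coe_mk, AddHom.coe_mk, pd, Subalgebra.coe_mul, Subalgebra.coe_add,
        smul_eq_mul, Pi.add_apply, Pi.mul_apply]
      rw [this]
      simp)

lemma Dv_coe {n : ℕ} (j : Fin n) (f : SR n) (x : E n) : (Dv j f : E n → ℝ) x = pd (f : E n → ℝ) j x :=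
  rfl

lemma pd_comm {n : ℕ} {f : E n → ℝ} {x : E n} (hf : ContDiffAt ℝ 2 f x) (i j : Fin n) :
    pd (fun y => pd f j y) i x = pd (fun y => pd f i y) j x := by
  have hs : IsSymmSndFDerivAt ℝ f x := hf.isSymmSndFDerivAt (by simp)
  have hd : DifferentiableAt ℝ (fderiv ℝ f) x :=
    (hf.fderiv_right (m := 1) (by norm_num)).differentiableAt (by simp)
  have key : ∀ a b : Fin n, pd (fun y => pd f b y) a x =
      fderiv ℝ (fderiv ℝ f) x (EuclideanSpace.single a 1) (EuclideanSpace.single b 1) := by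
    intro a b
    unfold pd
    rw [fderiv_clm_apply hd (differentiableAt_const _)]
    simp
  rw [key, key]
  exact hs _ _

/-- evaluation -/
def evx {n : ℕ} (x : E n) : SR n →ₐ[ℝ] ℝ := (Pi.evalAlgHom ℝ (fun _ : E n => ℝ) x).comp (SR n).val

lemma evx_apply {n : ℕ} (x : E n) (f : SR n) : evx x f = (f : E n → ℝ) x := rfl

lemma div_smooth {n : ℕ} (k : ℕ) (α : ℝ) (w : E n → ℝ) (hw : ContDiff ℝ ∞ w)
    (hpos : ∀ x, 0 < w x) :
    (∀ j, ContDiff ℝ ∞ (fun y => XX k α (w y) (fun l => pd w l y) (hess w y) j)) ∧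
    ∀ x, ∑ j, pd (fun y => XX k α (w y) (fun l => pd w l y) (hess w y) j) j x =
      FF k α (w x) (fun l => pd w l x) (hess w x) := by
  set wr : SR n := ⟨w, hw⟩ with hwr
  have hWs : ∀ β : ℝ, ContDiff ℝ ∞ (fun x => w x ^ β) := fun β =>
    hw.rpow_const_of_ne (fun x => (hpos x).ne')
  set W : ℕ → SR n := fun i => ⟨fun x => w x ^ (α + i), hWs _⟩ with hW
  have h := div_identity (R := SR n) Dv (fun i j f => by
    apply Subtype.ext
    funext x
    exact pd_comm ((SR_smooth f).contDiffAt.of_le (by norm_cast)) i j)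
    wr k α W (by
      intro i j
      apply Subtype.ext
      funext x
      have hd : HasFDerivAt w (fderiv ℝ w x) x := (SR_diff wr x).hasFDerivAt
      have := (hd.rpow_const (p := α + (i + 1 : ℕ)) (Or.inl (hpos x).ne')).fderiv
      rw [Dv_coe]
      simp only [hW, pd, Subalgebra.coe_mul, Pi.mul_apply]
      rw [this]
      have e : α + ((i + 1 : ℕ) : ℝ) - 1 = α + i := by push_cast; ring
      rw [e]
      simp only [_root_.smul_apply, smul_eq_mul]
      have e2 : (((algebraMap ℝ (SR n)) (α + i + 1) : SR n) : E n → ℝ) x = α + i + 1 := rfl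
      rw [e2]
      have e3 : ((Dv j wr : SR n) : E n → ℝ) x = fderiv ℝ w x (EuclideanSpace.single j 1) := rfl
      rw [e3]; push_cast; ring)
  have hM : ∀ x, (Matrix.of fun a b => Dv a (Dv b wr)).map (evx x) = hess w x := by
    intro x; rfl
  have hX : ∀ j, (fun y => XX k α (w y) (fun l => pd w l y) (hess w y) j) =
      ((∑ i ∈ Finset.range k, algebraMap ℝ (SR n) (ec k α (i + 1)) * W (i + 1) *
        (∑ l, Dv l wr ^ 2) ^ (k - 1 - i) *
        ((NT i (Matrix.of fun a b => Dv a (Dv b wr))).mulVec (fun l => Dv l wr)) j : SR n) :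
          E n → ℝ) := by
    intro j
    funext x
    rw [← evx_apply x]
    rw [map_sum]
    unfold XX
    apply Finset.sum_congr rfl
    intro i _
    rw [← hM, (NT_map (evx x) i _).1]
    simp only [map_mul, map_pow, map_sum, Matrix.mulVec, dotProduct, Matrix.map_apply,
      AlgHom.commutes, Algebra.algebraMap_self, RingHom.id_apply, evx_apply, Dv_coe, hW]
    push_cast
    rw [add_assoc]
  refine ⟨fun j => ?_, fun x => ?_⟩
  · rw [hX j]
    exact Subtype.prop (p := fun f => f ∈ SR n) _
  · have h2 := congrArg (evx x) h
    rw [map_sum] at h2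
    simp only [hX]
    refine Eq.trans h2 ?_
    rw [map_sum]
    unfold FF
    apply Finset.sum_congr rfl
    intro i _
    rw [← hM, (NT_map (evx x) i _).2]
    simp only [map_mul, map_pow, map_sum,
      AlgHom.commutes, Algebra.algebraMap_self, RingHom.id_apply, evx_apply, Dv_coe, hW, hwr]

lemma null_smooth {n : ℕ} (k : ℕ) (α : ℝ) (w χ : E n → ℝ) (hw : ContDiff ℝ ∞ w)
    (hpos : ∀ x, 0 < w x) (hχ : ContDiff ℝ ∞ χ) (hc : HasCompactSupport χ) :
    ∫ x, χ x * FF k α (w x) (fun l => pd w l x) (hess w x) =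
      - ∫ x, ∑ j, pd χ j x * XX k α (w x) (fun l => pd w l x) (hess w x) j := by
  obtain ⟨h1, h2⟩ := div_smooth k α w hw hpos
  have hcd : ∀ j, HasCompactSupport (fun x => pd χ j x) := fun j => hc.fderiv_apply ℝ _
  have i1 : ∀ j, Integrable (fun x => χ x *
      pd (fun y => XX k α (w y) (fun l => pd w l y) (hess w y) j) j x) := fun j =>
    ((hχ.mul (pd_smooth (h1 j) j)).continuous).integrable_of_hasCompactSupport hc.mul_right
  have i2 : ∀ j, Integrable (fun x => pd χ j x *
      XX k α (w x) (fun l => pd w l x) (hess w x) j) := fun j =>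
    (((pd_smooth hχ j).mul (h1 j)).continuous).integrable_of_hasCompactSupport (hcd j).mul_right
  have i3 : ∀ j, Integrable (fun x => χ x *
      XX k α (w x) (fun l => pd w l x) (hess w x) j) := fun j =>
    ((hχ.mul (h1 j)).continuous).integrable_of_hasCompactSupport hc.mul_right
  simp only [← h2, Finset.mul_sum]
  rw [integral_finsetSum _ (fun j _ => i1 j), integral_finsetSum _ (fun j _ => i2 j),
    ← Finset.sum_neg_distrib]
  apply Finset.sum_congr rfl
  intro j _
  exact integral_mul_fderiv_eq_neg_fderiv_mul_of_integrable (i2 j) (i1 j) (i3 j)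
    (fun x _ => hχ.differentiable (by simp) x) (fun x _ => (h1 j).differentiable (by simp) x)

end smooth

/-! ## Part E: mollification -/

section moll
open scoped ContDiff Topology Manifold
open Filter

lemma FF_cont {n : ℕ} (k : ℕ) {α : ℝ} (hα : 0 ≤ α) :
    Continuous (fun q : ℝ × (Fin n → ℝ) × Matrix (Fin n) (Fin n) ℝ => FF k α q.1 q.2.1 q.2.2) := by
  unfold FF
  apply continuous_finsetSum
  intro i _
  refine ((continuous_const.mul ?_).mul ?_).mul ?_
  · exact (Real.continuous_rpow_const (by positivity)).comp continuous_fst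
  · apply Continuous.pow
    apply continuous_finsetSum
    intro l _
    exact ((continuous_apply l).comp (continuous_fst.comp continuous_snd)).pow 2
  · exact (HH_continuous i).2.comp (continuous_snd.comp continuous_snd)

lemma XX_cont {n : ℕ} (k : ℕ) {α : ℝ} (hα : 0 ≤ α) (j : Fin n) :
    Continuous (fun q : ℝ × (Fin n → ℝ) × Matrix (Fin n) (Fin n) ℝ =>
      XX k α q.1 q.2.1 q.2.2 j) := by
  unfold XX
  apply continuous_finsetSum
  intro i _
  refine ((continuous_const.mul ?_).mul ?_).mul ?_
  · exact (Real.continuous_rpow_const (by positivity)).comp continuous_fst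
  · apply Continuous.pow
    apply continuous_finsetSum
    intro l _
    exact ((continuous_apply l).comp (continuous_fst.comp continuous_snd)).pow 2
  · have : Continuous (fun q : ℝ × (Fin n → ℝ) × Matrix (Fin n) (Fin n) ℝ =>
        (NT i q.2.2).mulVec q.2.1) :=
      Continuous.matrix_mulVec ((HH_continuous i).1.comp (continuous_snd.comp continuous_snd))
        (continuous_fst.comp continuous_snd)
    exact (continuous_apply j).comp this

lemma jet_bound {n : ℕ} (f : ℝ × (Fin n → ℝ) × Matrix (Fin n) (Fin n) ℝ → ℝ) (hf : Continuous f)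
    (C : ℝ) : ∃ K, ∀ (w : ℝ) (p : Fin n → ℝ) (M : Matrix (Fin n) (Fin n) ℝ), |w| ≤ C → (∀ l, |p l| ≤ C) → (∀ i j, |M i j| ≤ C) →
      |f (w, p, M)| ≤ K := by
  have hc : IsCompact ((Set.Icc (-C) C) ×ˢ ((Set.univ.pi fun _ : Fin n => Set.Icc (-C) C) ×ˢ
      (Set.univ.pi fun _ : Fin n => Set.univ.pi fun _ : Fin n => Set.Icc (-C) C)) :
      Set (ℝ × (Fin n → ℝ) × Matrix (Fin n) (Fin n) ℝ)) := by
    refine isCompact_Icc.prod (IsCompact.prod ?_ ?_)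
    · exact isCompact_univ_pi fun _ => isCompact_Icc
    · exact isCompact_univ_pi fun _ => isCompact_univ_pi fun _ => isCompact_Icc
  obtain ⟨K, hK⟩ := hc.exists_bound_of_continuousOn hf.continuousOn
  refine ⟨K, fun w p M h1 h2 h3 => ?_⟩
  have := hK (w, p, M) ⟨abs_le.1 h1, fun l _ => abs_le.1 (h2 l),
    fun i _ j _ => abs_le.1 (h3 i j)⟩
  rw [← Real.norm_eq_abs]
  exact this

lemma cutoff {n : ℕ} {K Ω : Set (E n)} (hK : IsCompact K) (hΩ : IsOpen Ω) (h : K ⊆ Ω) :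
    ∃ χ : E n → ℝ, ContDiff ℝ ∞ χ ∧ HasCompactSupport χ ∧ tsupport χ ⊆ Ω ∧
      (∀ᶠ x in 𝓝ˢ K, χ x = 1) ∧ ∀ x, χ x ∈ Set.Icc (0 : ℝ) 1 := by
  obtain ⟨L, hL, h1, h2⟩ := exists_compact_between hK hΩ h
  obtain ⟨f, f1, f2, f3⟩ := exists_contMDiffMap_one_nhds_of_subset_interior (n := (⊤ : ℕ∞))
    (𝓘(ℝ, E n)) hK.isClosed h1
  have hs : tsupport (f : E n → ℝ) ⊆ L := by
    apply closure_minimal _ hL.isClosed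
    intro x hx
    by_contra hxL
    exact hx (f2 x hxL)
  exact ⟨f, f.contMDiff.contDiff, HasCompactSupport.of_support_subset_isCompact hL
    (subset_closure.trans hs), hs.trans h2, f1, f3⟩

/-- mollification -/
def ms {n : ℕ} (φ : ContDiffBump (0 : E n)) (g : E n → ℝ) : E n → ℝ :=
  convolution (φ.normed volume) g (ContinuousLinearMap.lsmul ℝ ℝ) volume

lemma ms_smooth {n : ℕ} (φ : ContDiffBump (0 : E n)) {g : E n → ℝ} (hg : Continuous g) :
    ContDiff ℝ ∞ (ms φ g) :=
  φ.hasCompactSupport_normed.contDiff_convolution_left _ φ.contDiff_normed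
    hg.locallyIntegrable

lemma ms_bound {n : ℕ} (φ : ContDiffBump (0 : E n)) {g : E n → ℝ} (hg : Continuous g)
    {C : ℝ} (hC : ∀ x, |g x| ≤ C) (x : E n) : |ms φ g x| ≤ 3 * C := by
  have := φ.dist_normed_convolution_le (μ := volume) (x₀ := x) (ε := 2 * C)
    hg.aestronglyMeasurable (fun y _ => by
      rw [Real.dist_eq]
      have := abs_sub (g y) (g x)
      linarith [hC x, hC y])
  have h2 : |ms φ g x - g x| ≤ 2 * C := this
  have h3 := abs_sub_abs_le_abs_sub (ms φ g x) (g x)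
  linarith [hC x]

lemma ms_lower {n : ℕ} {g : E n → ℝ} (hg : Continuous g)
    (hc : HasCompactSupport g) {ε : ℝ} (hε : 0 < ε) :
    ∃ δ > 0, ∀ φ : ContDiffBump (0 : E n), φ.rOut < δ → ∀ x, |ms φ g x - g x| ≤ ε := by
  have hu := hc.uniformContinuous_of_continuous hg
  obtain ⟨δ, hδ, h⟩ := Metric.uniformContinuous_iff.1 hu ε hε
  refine ⟨δ, hδ, fun φ hφ x => ?_⟩
  exact φ.dist_normed_convolution_le (μ := volume) (x₀ := x) (ε := ε)
    hg.aestronglyMeasurable (fun y hy => (h (lt_trans hy hφ)).le)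

lemma pd_ms {n : ℕ} (φ : ContDiffBump (0 : E n)) {g : E n → ℝ} (hg : ContDiff ℝ 1 g)
    (hc : HasCompactSupport g) (j : Fin n) :
    (fun x => pd (ms φ g) j x) = ms φ (fun x => pd g j x) := by
  funext x
  have h := hc.hasFDerivAt_convolution_right (ContinuousLinearMap.lsmul ℝ ℝ) (μ := volume)
    (f := φ.normed volume) (φ.continuous_normed.locallyIntegrable) hg x
  unfold pd
  rw [show fderiv ℝ (ms φ g) x = _ from h.fderiv]
  have h2 := convolution_precompR_apply (𝕜 := ℝ) (L := ContinuousLinearMap.lsmul ℝ ℝ) (μ := volume)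
    (f := φ.normed volume) (g := fderiv ℝ g) (φ.continuous_normed.locallyIntegrable)
    (hc.fderiv ℝ) (hg.continuous_fderiv (by simp)) x (EuclideanSpace.single j 1)
  rw [h2]
  rfl

lemma pd_cont1 {n : ℕ} {g : E n → ℝ} (hg : ContDiff ℝ 2 g) (j : Fin n) :
    ContDiff ℝ 1 (fun x => pd g j x) := by
  unfold pd
  exact (hg.fderiv_right (m := 1) (by norm_num)).clm_apply contDiff_const

lemma pd_cont0 {n : ℕ} {g : E n → ℝ} (hg : ContDiff ℝ 1 g) (j : Fin n) :
    Continuous (fun x => pd g j x) := by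
  unfold pd
  exact (hg.continuous_fderiv (by simp)).clm_apply continuous_const

lemma jet_cont {n : ℕ} {w : E n → ℝ} (hw : ContDiff ℝ 2 w) :
    Continuous (fun x => (w x, (fun l => pd w l x), hess w x)) := by
  refine hw.continuous.prodMk (Continuous.prodMk ?_ ?_)
  · exact continuous_pi fun l => pd_cont0 (hw.of_le (by norm_num)) l
  · exact continuous_pi fun i => continuous_pi fun j => pd_cont0 (pd_cont1 hw j) i

lemma jet_tendsto {n : ℕ} (wm : ℕ → E n → ℝ) (w : E n → ℝ) (x : E n)
    (h0 : Tendsto (fun m => wm m x) atTop (𝓝 (w x)))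
    (h1 : ∀ l, Tendsto (fun m => pd (wm m) l x) atTop (𝓝 (pd w l x)))
    (h2 : ∀ i j, Tendsto (fun m => hess (wm m) x i j) atTop (𝓝 (hess w x i j))) :
    Tendsto (fun m => (wm m x, (fun l => pd (wm m) l x), hess (wm m) x)) atTop
      (𝓝 (w x, (fun l => pd w l x), hess w x)) := by
  refine h0.prodMk_nhds (Tendsto.prodMk_nhds ?_ ?_)
  · exact tendsto_pi_nhds.2 h1
  · exact tendsto_pi_nhds.2 fun i => tendsto_pi_nhds.2 fun j => h2 i j

end moll

/-! ## Part F: null Lagrangian for C² functions -/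

section null
open scoped ContDiff Topology Manifold
open Filter

lemma null_global {n : ℕ} (k : ℕ) {α : ℝ} (hα : 0 ≤ α) (w χ : E n → ℝ) (hw : ContDiff ℝ 2 w)
    {c : ℝ} (hc : 0 < c) (hpos : ∀ x, c ≤ w x) (hcs : HasCompactSupport (fun x => w x - 1))
    (hχ : ContDiff ℝ ∞ χ) (hχc : HasCompactSupport χ) :
    ∫ x, χ x * FF k α (w x) (fun l => pd w l x) (hess w x) =
      - ∫ x, ∑ j, pd χ j x * XX k α (w x) (fun l => pd w l x) (hess w x) j := by
  set G : E n → ℝ := fun x => w x - 1 with hG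
  have hGd : ContDiff ℝ 2 G := hw.sub contDiff_const
  have hG1 : ContDiff ℝ 1 G := hGd.of_le (by norm_num)
  have hpG : ∀ j x, pd G j x = pd w j x := by
    intro j x; simp only [pd, hG, fderiv_sub_const]
  have hc1 : ∀ j, HasCompactSupport (fun x => pd G j x) := fun j => hcs.fderiv_apply ℝ _
  have hc2 : ∀ i j, HasCompactSupport (fun x => pd (fun y => pd G j y) i x) :=
    fun i j => (hc1 j).fderiv_apply ℝ _
  set φ : ℕ → ContDiffBump (0 : E n) := fun m =>
    ⟨1 / (2 * ((m : ℝ) + 1)), 1 / ((m : ℝ) + 1), by positivity, by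
      apply one_div_lt_one_div_of_lt <;> nlinarith [(Nat.cast_nonneg m : (0 : ℝ) ≤ m)]⟩ with hφ
  have hφ0 : Tendsto (fun m => (φ m).rOut) atTop (𝓝 0) := tendsto_one_div_add_atTop_nhds_zero_nat
  set wm : ℕ → E n → ℝ := fun m x => ms (φ m) G x + 1 with hwm
  have p1 : ∀ m j x, pd (wm m) j x = ms (φ m) (fun x => pd G j x) x := by
    intro m j x
    rw [← pd_ms (φ m) hG1 hcs j]
    simp only [pd, hwm, fderiv_add_const]
  have p2 : ∀ m i j x, hess (wm m) x i j = ms (φ m) (fun x => pd (fun y => pd G j y) i x) x := by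
    intro m i j x
    rw [← pd_ms (φ m) (pd_cont1 hGd j) (hc1 j) i]
    simp only [hess, Matrix.of_apply]
    congr 1
    funext y
    exact p1 m j y
  have hws : ∀ m, ContDiff ℝ ∞ (wm m) := fun m => (ms_smooth (φ m) hG1.continuous).add contDiff_const
  have hw2 : ∀ m, ContDiff ℝ 2 (wm m) := fun m => (hws m).of_le (by norm_cast)
  -- bounds
  have hb : ∀ f : E n → ℝ, Continuous f → HasCompactSupport f → ∃ C, ∀ x, |f x| ≤ C := by
    intro f h1 h2
    obtain ⟨C, hC⟩ := h2.exists_bound_of_continuous h1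
    exact ⟨C, hC⟩
  obtain ⟨C0, hC0⟩ := hb G hG1.continuous hcs
  choose C1 hC1 using fun j => hb _ (pd_cont0 hG1 j) (hc1 j)
  choose C2 hC2 using fun i j => hb _ (pd_cont0 (pd_cont1 hGd j) i) (hc2 i j)
  have hC0' : 0 ≤ C0 := (abs_nonneg _).trans (hC0 0)
  have hC1' : ∀ j, 0 ≤ C1 j := fun j => (abs_nonneg _).trans (hC1 j 0)
  have hC2' : ∀ i j, 0 ≤ C2 i j := fun i j => (abs_nonneg _).trans (hC2 i j 0)
  set C : ℝ := 3 * (C0 + ∑ j, C1 j + ∑ i, ∑ j, C2 i j) + 1 with hC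
  have hs1 : ∀ j, C1 j ≤ ∑ j, C1 j := fun j =>
    Finset.single_le_sum (fun j _ => hC1' j) (Finset.mem_univ j)
  have hs2 : ∀ i j, C2 i j ≤ ∑ i, ∑ j, C2 i j := fun i j =>
    (Finset.single_le_sum (f := fun j => C2 i j) (fun j _ => hC2' i j) (Finset.mem_univ j)).trans
    (Finset.single_le_sum (f := fun i => ∑ j, C2 i j)
      (fun i _ => Finset.sum_nonneg fun j _ => hC2' i j) (Finset.mem_univ i))
  have hn1 : 0 ≤ ∑ j, C1 j := Finset.sum_nonneg fun j _ => hC1' j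
  have hn2 : 0 ≤ ∑ i, ∑ j, C2 i j := Finset.sum_nonneg fun i _ => Finset.sum_nonneg fun j _ => hC2' i j
  have b0 : ∀ m x, |wm m x| ≤ C := by
    intro m x
    have := ms_bound (φ m) hG1.continuous hC0 x
    have h2 := abs_add_le (ms (φ m) G x) 1
    rw [abs_one] at h2
    simp only [hwm]
    linarith
  have b1 : ∀ m j x, |pd (wm m) j x| ≤ C := by
    intro m j x
    rw [p1]
    have := ms_bound (φ m) (pd_cont0 hG1 j) (hC1 j) x
    linarith [hs1 j]
  have b2 : ∀ m i j x, |hess (wm m) x i j| ≤ C := by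
    intro m i j x
    rw [p2]
    have := ms_bound (φ m) (pd_cont0 (pd_cont1 hGd j) i) (hC2 i j) x
    linarith [hs2 i j]
  have hjt : ∀ x, Tendsto (fun m => (wm m x, (fun l => pd (wm m) l x), hess (wm m) x)) atTop
      (𝓝 (w x, (fun l => pd w l x), hess w x)) := by
    intro x
    apply jet_tendsto
    · have := ContDiffBump.convolution_tendsto_right_of_continuous (μ := volume) hφ0
        hG1.continuous x
      have := this.add_const 1
      have e : G x + 1 = w x := by simp [hG]
      rw [e] at this
      exact this
    · intro l
      simp only [p1]
      have := ContDiffBump.convolution_tendsto_right_of_continuous (μ := volume) hφ0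
        (pd_cont0 hG1 l) x
      rw [hpG] at this
      exact this
    · intro i j
      simp only [p2]
      have := ContDiffBump.convolution_tendsto_right_of_continuous (μ := volume) hφ0
        (pd_cont0 (pd_cont1 hGd j) i) x
      have e : hess w x i j = pd (fun y => pd G j y) i x := by
        simp only [hess, Matrix.of_apply, hpG]
      rw [e]
      exact this
  -- eventual identity
  have hev : ∀ᶠ m in atTop, ∫ x, χ x * FF k α (wm m x) (fun l => pd (wm m) l x) (hess (wm m) x) =
      - ∫ x, ∑ j, pd χ j x * XX k α (wm m x) (fun l => pd (wm m) l x) (hess (wm m) x) j := by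
    obtain ⟨δ, hδ, h⟩ := ms_lower hG1.continuous hcs (half_pos hc)
    filter_upwards [hφ0.eventually (gt_mem_nhds hδ)] with m hm
    apply null_smooth k α (wm m) χ (hws m) _ hχ hχc
    intro x
    have h1 := (abs_le.1 (h (φ m) hm x)).1
    have h2 := hpos x
    simp only [hwm]
    simp only [hG] at h1 ⊢
    linarith
  have hχ1 : ContDiff ℝ 1 χ := hχ.of_le (by norm_cast)
  -- limits
  have l1 : Tendsto (fun m => ∫ x, χ x * FF k α (wm m x) (fun l => pd (wm m) l x) (hess (wm m) x))
      atTop (𝓝 (∫ x, χ x * FF k α (w x) (fun l => pd w l x) (hess w x))) := by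
    obtain ⟨K, hK⟩ := jet_bound _ (FF_cont (n := n) k hα) C
    apply tendsto_integral_of_dominated_convergence (fun x => |χ x| * K)
    · intro m
      exact (hχ.continuous.mul ((FF_cont k hα).comp (jet_cont (hw2 m)))).aestronglyMeasurable
    · apply Integrable.mul_const
      exact (hχ.continuous.integrable_of_hasCompactSupport hχc).abs
    · intro m
      refine Eventually.of_forall fun x => ?_
      rw [Real.norm_eq_abs, abs_mul]
      exact mul_le_mul_of_nonneg_left (hK _ _ _ (b0 m x) (fun l => b1 m l x)
        (fun i j => b2 m i j x)) (abs_nonneg _)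
    · refine Eventually.of_forall fun x => ?_
      exact (((FF_cont k hα).tendsto _).comp (hjt x)).const_mul _
  have l2 : Tendsto (fun m => ∫ x, ∑ j, pd χ j x *
      XX k α (wm m x) (fun l => pd (wm m) l x) (hess (wm m) x) j)
      atTop (𝓝 (∫ x, ∑ j, pd χ j x * XX k α (w x) (fun l => pd w l x) (hess w x) j)) := by
    choose K hK using fun j => jet_bound _ (XX_cont (n := n) k hα j) C
    apply tendsto_integral_of_dominated_convergence (fun x => ∑ j, |pd χ j x| * K j)
    · intro m
      refine Continuous.aestronglyMeasurable ?_
      apply continuous_finsetSum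
      intro j _
      exact (pd_cont0 hχ1 j).mul ((XX_cont k hα j).comp (jet_cont (hw2 m)))
    · apply integrable_finsetSum
      intro j _
      apply Integrable.mul_const
      exact ((pd_cont0 hχ1 j).integrable_of_hasCompactSupport (hχc.fderiv_apply ℝ _)).abs
    · intro m
      refine Eventually.of_forall fun x => ?_
      rw [Real.norm_eq_abs]
      refine (Finset.abs_sum_le_sum_abs _ _).trans (Finset.sum_le_sum fun j _ => ?_)
      rw [abs_mul]
      exact mul_le_mul_of_nonneg_left (hK j _ _ _ (b0 m x) (fun l => b1 m l x)
        (fun i j => b2 m i j x)) (abs_nonneg _)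
    · refine Eventually.of_forall fun x => ?_
      apply tendsto_finsetSum
      intro j _
      exact (((XX_cont k hα j).tendsto _).comp (hjt x)).const_mul _
  exact tendsto_nhds_unique (l1.congr' hev) l2.neg

lemma pd_congr {n : ℕ} {f g : E n → ℝ} {x : E n} (h : f =ᶠ[𝓝 x] g) (j : Fin n) :
    pd f j x = pd g j x := by
  unfold pd; rw [h.fderiv_eq]

lemma hess_congr {n : ℕ} {f g : E n → ℝ} {x : E n} (h : f =ᶠ[𝓝 x] g) :
    hess f x = hess g x := by
  ext i j
  simp only [hess, Matrix.of_apply]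
  apply pd_congr
  filter_upwards [h.eventuallyEq_nhds] with y hy
  exact pd_congr hy j

/-- integrand of a function -/
def FI {n : ℕ} (k : ℕ) (α : ℝ) (w : E n → ℝ) (x : E n) : ℝ :=
  FF k α (w x) (fun l => pd w l x) (hess w x)

lemma FI_congr {n : ℕ} (k : ℕ) (α : ℝ) {f g : E n → ℝ} {x : E n} (h : f =ᶠ[𝓝 x] g) :
    FI k α f x = FI k α g x := by
  unfold FI
  rw [h.eq_of_nhds, hess_congr h, funext fun l => pd_congr h l]

lemma pd_eq_zero {n : ℕ} {χ : E n → ℝ} {x : E n} (hx : x ∉ tsupport χ) (j : Fin n) :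
    pd χ j x = 0 := by
  have h : χ =ᶠ[𝓝 x] fun _ => 0 := notMem_tsupport_iff_eventuallyEq.1 hx
  rw [pd_congr h]; simp [pd]

/-- null Lagrangian identity for C² functions on an open set -/
lemma null_C2 {n : ℕ} (k : ℕ) {α : ℝ} (hα : 0 ≤ α) {Ω : Set (E n)} (hΩ : IsOpen Ω)
    (w χ : E n → ℝ) (hw : ContDiffOn ℝ 2 w Ω) (hpos : ∀ x ∈ Ω, 0 < w x)
    (hχ : ContDiff ℝ ∞ χ) (hχc : HasCompactSupport χ) (hχΩ : tsupport χ ⊆ Ω) :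
    ∫ x, χ x * FI k α w x =
      - ∫ x, ∑ j, pd χ j x * XX k α (w x) (fun l => pd w l x) (hess w x) j := by
  obtain ⟨η, e1, e2, e3, e4, e5⟩ := cutoff hχc.isCompact hΩ hχΩ
  set g : E n → ℝ := fun x => η x * (w x - 1) with hg
  have hgs : ContDiff ℝ 2 g := by
    rw [contDiff_iff_contDiffAt]
    intro x
    by_cases hx : x ∈ Ω
    · exact ((e1.contDiffAt).of_le (by norm_cast)).mul
        ((hw.contDiffAt (hΩ.mem_nhds hx)).sub contDiffAt_const)
    · have h0 : η =ᶠ[𝓝 x] fun _ => 0 := notMem_tsupport_iff_eventuallyEq.1 (fun h => hx (e3 h))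
      have : g =ᶠ[𝓝 x] fun _ => 0 := by
        filter_upwards [h0] with y hy
        simp [hg, hy]
      exact contDiffAt_const.congr_of_eventuallyEq this
  have hgc : HasCompactSupport g := e2.mul_right
  set z : E n → ℝ := fun x => 1 + g x with hz
  have hzs : ContDiff ℝ 2 z := contDiff_const.add hgs
  have hzc : HasCompactSupport (fun x => z x - 1) := by
    simpa [hz] using hgc
  have hzpos : ∀ x, 0 < z x := by
    intro x
    by_cases hx : x ∈ Ω
    · have h1 := e5 x
      have h2 := hpos x hx
      have : z x = (1 - η x) + η x * w x := by simp only [hz, hg]; ring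
      rw [this]
      rcases eq_or_lt_of_le h1.2 with h | h
      · rw [h]; simpa using h2
      · have := mul_nonneg h1.1 h2.le
        linarith
    · have : η x = 0 := by
        by_contra h
        exact hx (e3 (subset_closure h))
      simp [hz, hg, this]
  obtain ⟨c, hc, hcz⟩ : ∃ c > 0, ∀ x, c ≤ z x := by
    have hK : IsCompact (insert 0 (tsupport g)) := hgc.isCompact.insert 0
    obtain ⟨x0, _, hx0⟩ := hK.exists_isMinOn ⟨0, Set.mem_insert _ _⟩ hzs.continuous.continuousOn
    refine ⟨min (z x0) 1, lt_min (hzpos x0) one_pos, fun x => ?_⟩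
    by_cases hx : x ∈ tsupport g
    · exact (min_le_left _ _).trans (hx0 (Set.mem_insert_of_mem _ hx))
    · have : g x = 0 := image_eq_zero_of_notMem_tsupport hx
      simp [hz, this]
  have hzw : ∀ x ∈ tsupport χ, z =ᶠ[𝓝 x] w := by
    intro x hx
    have := (eventually_nhdsSet_iff_forall.1 e4) x hx
    filter_upwards [this] with y hy
    simp [hz, hg, hy]
  have h := null_global k hα z χ hzs hc hcz hzc hχ hχc
  have r1 : ∀ x, χ x * FF k α (z x) (fun l => pd z l x) (hess z x) = χ x * FI k α w x := by
    intro x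
    by_cases hx : x ∈ tsupport χ
    · rw [← FI_congr k α (hzw x hx)]; rfl
    · rw [image_eq_zero_of_notMem_tsupport hx]; simp
  have r2 : ∀ x, ∑ j, pd χ j x * XX k α (z x) (fun l => pd z l x) (hess z x) j =
      ∑ j, pd χ j x * XX k α (w x) (fun l => pd w l x) (hess w x) j := by
    intro x
    by_cases hx : x ∈ tsupport χ
    · have h := hzw x hx
      rw [h.eq_of_nhds, hess_congr h, funext fun l => pd_congr h l]
    · simp [pd_eq_zero hx]
  simp only [r1, r2] at h
  exact h

/-- consequence: integrals agree for functions that agree off a compact set -/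
lemma null_compare {n : ℕ} (k : ℕ) {α : ℝ} (hα : 0 ≤ α) {Ω K : Set (E n)} (hΩ : IsOpen Ω)
    (hK : IsCompact K) (hKΩ : K ⊆ Ω)
    (z v : E n → ℝ) (hz : ContDiffOn ℝ 2 z Ω) (hv : ContDiffOn ℝ 2 v Ω)
    (hzpos : ∀ x ∈ Ω, 0 < z x) (hvpos : ∀ x ∈ Ω, 0 < v x)
    (hzv : ∀ x ∈ Ω \ K, z x = v x)
    (hiz : IntegrableOn (FI k α z) Ω) (hiv : IntegrableOn (FI k α v) Ω) :
    ∫ x in Ω, FI k α z x = ∫ x in Ω, FI k α v x := by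
  obtain ⟨χ, e1, e2, e3, e4, e5⟩ := cutoff hK hΩ hKΩ
  have h1 := null_C2 k hα hΩ z χ hz hzpos e1 e2 e3
  have h2 := null_C2 k hα hΩ v χ hv hvpos e1 e2 e3
  have hnear : ∀ x ∈ Ω \ K, z =ᶠ[𝓝 x] v := by
    intro x hx
    filter_upwards [(hΩ.sdiff hK.isClosed).mem_nhds hx] with y hy
    exact hzv y hy
  have r2 : ∀ x, ∑ j, pd χ j x * XX k α (z x) (fun l => pd z l x) (hess z x) j =
      ∑ j, pd χ j x * XX k α (v x) (fun l => pd v l x) (hess v x) j := by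
    intro x
    by_cases hx : x ∈ tsupport χ
    · by_cases hxK : x ∈ K
      · have h0 : χ =ᶠ[𝓝 x] fun _ => 1 := (eventually_nhdsSet_iff_forall.1 e4) x hxK
        have : ∀ j, pd χ j x = 0 := by
          intro j; rw [pd_congr h0]; simp [pd]
        simp [this]
      · have h := hnear x ⟨e3 hx, hxK⟩
        rw [h.eq_of_nhds, hess_congr h, funext fun l => pd_congr h l]
    · simp [pd_eq_zero hx]
  have h3 : ∫ x, χ x * FI k α z x = ∫ x, χ x * FI k α v x := by
    rw [h1, h2]; simp only [r2]
  have h4 : ∀ w : E n → ℝ, ∫ x, χ x * FI k α w x = ∫ x in Ω, χ x * FI k α w x := by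
    intro w
    rw [setIntegral_eq_integral_of_forall_compl_eq_zero]
    intro x hx
    have : χ x = 0 := by
      by_contra h
      exact hx (e3 (subset_closure h))
    simp [this]
  rw [h4, h4] at h3
  have hm : ∀ w : E n → ℝ, IntegrableOn (FI k α w) Ω → IntegrableOn (fun x => χ x * FI k α w x) Ω := by
    intro w hw
    apply Integrable.bdd_mul (c := 1) hw e1.continuous.aestronglyMeasurable
    refine Eventually.of_forall fun x => ?_
    rw [Real.norm_eq_abs, abs_le]
    constructor <;> linarith [(e5 x).1, (e5 x).2]
  have h5 : ∫ x in Ω, (FI k α z x - χ x * FI k α z x) = ∫ x in Ω, (FI k α v x - χ x * FI k α v x) := by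
    apply setIntegral_congr_fun hΩ.measurableSet
    intro x hx
    by_cases hxK : x ∈ K
    · have : χ x = 1 := ((eventually_nhdsSet_iff_forall.1 e4) x hxK).self_of_nhds
      simp [this]
    · simp only [FI_congr k α (hnear x ⟨hx, hxK⟩)]
  rw [integral_sub hiz (hm z hiz), integral_sub hiv (hm v hiv)] at h5
  linarith

end null

/-! ## Part G: gluing -/

section glue
open scoped ContDiff Topology
open Filter

lemma maxpow_deriv (m : ℕ) (hm : 1 ≤ m) (t : ℝ) :
    HasDerivAt (fun t : ℝ => (max t 0) ^ (m + 1)) ((m + 1) * (max t 0) ^ m) t := by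
  rcases lt_trichotomy t 0 with h | h | h
  · have e : (fun t : ℝ => (max t 0) ^ (m + 1)) =ᶠ[𝓝 t] fun _ => 0 := by
      filter_upwards [gt_mem_nhds h] with y hy
      rw [max_eq_right hy.le]; simp
    rw [max_eq_right h.le, zero_pow (by omega), mul_zero]
    exact (hasDerivAt_const t (0 : ℝ)).congr_of_eventuallyEq e
  · subst h
    simp only [max_self]
    rw [zero_pow (by omega), mul_zero]
    have h1 : HasDerivAt (fun t : ℝ => t ^ (m + 1)) 0 0 := by
      have := hasDerivAt_pow (m + 1) (0 : ℝ)
      simpa [zero_pow (show m ≠ 0 by omega)] using this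
    rw [hasDerivAt_iff_isLittleO] at h1 ⊢
    refine Asymptotics.IsBigO.trans_isLittleO ?_ h1
    refine Asymptotics.IsBigO.of_bound 1 (Eventually.of_forall fun y => ?_)
    simp only [max_self, smul_zero, sub_zero, one_mul, Real.norm_eq_abs]
    rw [zero_pow (by omega), sub_zero, sub_zero, abs_pow, abs_pow]
    apply pow_le_pow_left₀ (abs_nonneg _)
    rw [abs_of_nonneg (le_max_right _ _)]
    exact max_le (le_abs_self _) (abs_nonneg _)
  · have e : (fun t : ℝ => (max t 0) ^ (m + 1)) =ᶠ[𝓝 t] fun t => t ^ (m + 1) := by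
      filter_upwards [lt_mem_nhds h] with y hy
      rw [max_eq_left hy.le]
    rw [max_eq_left h.le]
    have := hasDerivAt_pow (m + 1) t
    simp only [Nat.add_sub_cancel] at this
    push_cast at this
    exact this.congr_of_eventuallyEq e

lemma exists_eta : ∃ h h1 h2 : ℝ → ℝ, (∀ s, HasDerivAt h (h1 s) s) ∧
    (∀ s, HasDerivAt h1 (h2 s) s) ∧ Continuous h2 ∧
    (∀ s, 0 ≤ h1 s ∧ h1 s ≤ 1 ∧ 0 ≤ h2 s ∧ 0 ≤ h s ∧ s * h1 s ≤ h s) ∧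
    (∀ s ≤ -1, h s = 0) ∧ (∀ s, 1 ≤ s → h s = s) := by
  set P : ℝ → ℝ := fun t => max t 0 with hP
  have d3 : ∀ t, HasDerivAt (fun t => P t ^ 3) (3 * P t ^ 2) t := by
    intro t
    have := maxpow_deriv 2 (by norm_num) t
    norm_num at this; exact this
  have d2 : ∀ t, HasDerivAt (fun t => P t ^ 2) (2 * P t) t := by
    intro t
    have := maxpow_deriv 1 (by norm_num) t
    norm_num at this; exact this
  have a3 : ∀ s, HasDerivAt (fun s => P (1 + s) ^ 3) (3 * P (1 + s) ^ 2) s := fun s => by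
    exact (d3 (1 + s)).comp_const_add 1 s
  have a2 : ∀ s, HasDerivAt (fun s => P (1 + s) ^ 2) (2 * P (1 + s)) s := fun s => by
    exact (d2 (1 + s)).comp_const_add 1 s
  have b3 : ∀ s, HasDerivAt (fun s => P (s - 1) ^ 3) (3 * P (s - 1) ^ 2) s := fun s => by
    exact (d3 (s - 1)).comp_sub_const s 1
  have b2 : ∀ s, HasDerivAt (fun s => P (s - 1) ^ 2) (2 * P (s - 1)) s := fun s => by
    exact (d2 (s - 1)).comp_sub_const s 1
  have c1 : ∀ s : ℝ, HasDerivAt (fun s => 3 - s) (-1) s := fun s => (hasDerivAt_id s).const_sub 3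
  have c2 : ∀ s : ℝ, HasDerivAt (fun s => 3 + s) 1 s := fun s => (hasDerivAt_id s).const_add 3
  refine ⟨fun s => (P (1 + s) ^ 3 * (3 - s) + P (s - 1) ^ 3 * (3 + s)) / 16,
    fun s => (3 * (P (1 + s) ^ 2 * (3 - s)) - P (1 + s) ^ 3 +
      (3 * (P (s - 1) ^ 2 * (3 + s)) + P (s - 1) ^ 3)) / 16,
    fun s => (6 * P (1 + s) * (3 - s) - 6 * P (1 + s) ^ 2 +
      (6 * P (s - 1) * (3 + s) + 6 * P (s - 1) ^ 2)) / 16, ?_, ?_, ?_, ?_, ?_, ?_⟩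
  · intro s
    have := (((a3 s).mul (c1 s)).add ((b3 s).mul (c2 s))).div_const 16
    refine HasDerivAt.congr_deriv this ?_
    ring
  · intro s
    have := (((((a2 s).mul (c1 s)).const_mul 3).sub (a3 s)).add
      ((((b2 s).mul (c2 s)).const_mul 3).add (b3 s))).div_const 16
    refine HasDerivAt.congr_deriv this ?_
    ring
  · have hPc : Continuous P := continuous_id.max continuous_const
    have h1 : Continuous fun s => P (1 + s) := hPc.comp (by fun_prop)
    have h2 : Continuous fun s => P (s - 1) := hPc.comp (by fun_prop)
    fun_prop
  · intro s
    rcases le_total s (-1) with h | h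
    · have e1 : P (1 + s) = 0 := max_eq_right (by linarith)
      have e2 : P (s - 1) = 0 := max_eq_right (by linarith)
      simp [e1, e2]
    rcases le_total s 1 with h' | h'
    · have e1 : P (1 + s) = 1 + s := max_eq_left (by linarith)
      have e2 : P (s - 1) = 0 := max_eq_right (by linarith)
      simp only [e1, e2]
      have f1 : 0 ≤ 1 + s := by linarith
      have f2 : 0 ≤ 1 - s := by linarith
      have f12 := mul_nonneg f1 f2
      refine ⟨?_, ?_, ?_, ?_, ?_⟩
      · have : 0 ≤ (1 + s) ^ 2 * (2 - s) := mul_nonneg (sq_nonneg _) (by linarith)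
        nlinarith
      · have : 0 ≤ (1 - s) ^ 2 * (2 + s) := mul_nonneg (sq_nonneg _) (by linarith)
        nlinarith
      · nlinarith
      · have : 0 ≤ (1 + s) ^ 3 * (3 - s) := mul_nonneg (pow_nonneg f1 3) (by linarith)
        nlinarith
      · have : 0 ≤ (1 - s ^ 2) ^ 2 := sq_nonneg _
        nlinarith
    · have e1 : P (1 + s) = 1 + s := max_eq_left (by linarith)
      have e2 : P (s - 1) = s - 1 := max_eq_left (by linarith)
      simp only [e1, e2]
      refine ⟨?_, ?_, ?_, ?_, ?_⟩ <;> ring_nf <;> linarith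
  · intro s h
    have e1 : P (1 + s) = 0 := max_eq_right (by linarith)
    have e2 : P (s - 1) = 0 := max_eq_right (by linarith)
    simp [e1, e2]
  · intro s h'
    have e1 : P (1 + s) = 1 + s := max_eq_left (by linarith)
    have e2 : P (s - 1) = s - 1 := max_eq_left (by linarith)
    simp only [e1, e2]
    ring

/-- the shape of A in terms of the jet -/
def AJ {n : ℕ} (w : ℝ) (p : Fin n → ℝ) (M : Matrix (Fin n) (Fin n) ℝ) : Matrix (Fin n) (Fin n) ℝ :=
  w • M - ((∑ l, p l ^ 2) / 2) • 1

lemma Amat_eq {n : ℕ} (w : E n → ℝ) (x : E n) :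
    Amat w x = AJ (w x) (fun l => pd w l x) (hess w x) := by
  ext i j
  simp only [Amat, AJ, Matrix.of_apply, Matrix.sub_apply, Matrix.smul_apply, smul_eq_mul,
    Matrix.one_apply, gradsq]
  ring

lemma cauchy_aux {a b z h1 h2 x y : ℝ} (ha : 0 < a) (hb : 0 < b) (h1n : 0 ≤ h1)
    (h2n : 0 ≤ h2) (hz : h1 * a + h2 * b ≤ z) :
    (h1 * x + h2 * y) ^ 2 ≤ z * h1 / a * x ^ 2 + z * h2 / b * y ^ 2 := by
  have h3 : (h1 * x + h2 * y) ^ 2 ≤ (h1 * a + h2 * b) * (h1 * x ^ 2 / a + h2 * y ^ 2 / b) := by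
    have e : (h1 * a + h2 * b) * (h1 * x ^ 2 / a + h2 * y ^ 2 / b) - (h1 * x + h2 * y) ^ 2 =
        h1 * h2 * (a * y - b * x) ^ 2 / (a * b) := by
      field_simp
      ring
    have : 0 ≤ h1 * h2 * (a * y - b * x) ^ 2 / (a * b) := by positivity
    linarith
  have h4 : 0 ≤ h1 * x ^ 2 / a + h2 * y ^ 2 / b := by positivity
  have h5 := mul_le_mul_of_nonneg_right hz h4
  have e : z * (h1 * x ^ 2 / a + h2 * y ^ 2 / b) = z * h1 / a * x ^ 2 + z * h2 / b * y ^ 2 := by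
    ring
  linarith

lemma cone_comb {n k : ℕ} (hk : k ≤ n) {a b z h1 h2 r : ℝ} {ga gb : Fin n → ℝ}
    {Da Db : Matrix (Fin n) (Fin n) ℝ} (ha : 0 < a) (hb : 0 < b) (hzp : 0 ≤ z) (h1n : 0 ≤ h1)
    (h2n : 0 ≤ h2) (hz : h1 * a + h2 * b ≤ z) (hr : 0 ≤ r) (q : Fin n → ℝ)
    (hA : CM k (AJ a ga Da)) (hB : CM k (AJ b gb Db)) :
    CM k (AJ z (fun l => h1 * ga l + h2 * gb l) (h1 • Da + h2 • Db + r • Matrix.vecMulVec q q)) := by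
  set c : ℝ := ∑ l, (z * h1 / a * ga l ^ 2 + z * h2 / b * gb l ^ 2 -
    (h1 * ga l + h2 * gb l) ^ 2) / 2 with hc
  have hcn : 0 ≤ c := by
    apply Finset.sum_nonneg
    intro l _
    have := cauchy_aux (x := ga l) (y := gb l) ha hb h1n h2n hz
    linarith
  have hone : CM k (1 : Matrix (Fin n) (Fin n) ℝ) := CM_psd Matrix.PosSemidef.one
  have hq : CM k (Matrix.vecMulVec q q) := CM_psd (by
    have := Matrix.posSemidef_vecMulVec_self_star q
    simpa using this)
  have e : AJ z (fun l => h1 * ga l + h2 * gb l) (h1 • Da + h2 • Db + r • Matrix.vecMulVec q q) =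
      (z * h1 / a) • AJ a ga Da + (z * h2 / b) • AJ b gb Db + (z * r) • Matrix.vecMulVec q q +
        c • (1 : Matrix (Fin n) (Fin n) ℝ) := by
    have hcs : c = z * h1 / a * ((∑ l, ga l ^ 2) / 2) + z * h2 / b * ((∑ l, gb l ^ 2) / 2) -
        (∑ l, (h1 * ga l + h2 * gb l) ^ 2) / 2 := by
      rw [hc, ← Finset.sum_div, Finset.sum_sub_distrib, Finset.sum_add_distrib, ← Finset.mul_sum,
        ← Finset.mul_sum]
      ring
    ext i j
    simp only [AJ, Matrix.add_apply, Matrix.sub_apply, Matrix.smul_apply, smul_eq_mul]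
    rw [hcs]
    field_simp
    ring
  rw [e]
  exact CM_add hk (CM_add hk (CM_add hk (CM_smul hA (by positivity)) (CM_smul hB (by positivity)))
    (CM_smul hq (by positivity))) (CM_smul hone hcn)

lemma FF_eq {n k : ℕ} (hk1 : 1 ≤ k) (hk : k ≤ n) (α : ℝ) {w : ℝ} (hw : 0 < w) (p : Fin n → ℝ)
    (M : Matrix (Fin n) (Fin n) ℝ) (hM : M.IsHermitian) :
    FF k α w p M = ∑ l ∈ Finset.range (k + 1), bcoef n k α l * w ^ α * (∑ l, p l ^ 2) ^ l *
      HH (k - l) (AJ w p M) := by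
  have h := conv_main M hM w (∑ l, p l ^ 2) α k hk1 hk
  have h2 := congrArg (fun t => w ^ α * t) h
  simp only [Finset.mul_sum] at h2
  unfold FF
  calc _ = ∑ i ∈ Finset.range (k + 1), w ^ α * (((2 * (k : ℝ) - i) * ec k α i) * w ^ i *
        (∑ l, p l ^ 2) ^ (k - i) * HH i M) := by
        apply Finset.sum_congr rfl
        intro i _
        rw [Real.rpow_add hw, Real.rpow_natCast]
        ring
    _ = _ := by
        rw [← h2]
        apply Finset.sum_congr rfl
        intro l _
        unfold AJ
        ring

lemma FF_nonneg {n k : ℕ} (hk1 : 1 ≤ k) (hk : k ≤ n) {α : ℝ} (hα : 0 ≤ α) {w : ℝ} (hw : 0 < w)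
    (p : Fin n → ℝ) (M : Matrix (Fin n) (Fin n) ℝ) (hM : M.IsHermitian) (hC : CM k (AJ w p M)) :
    0 ≤ FF k α w p M := by
  rw [FF_eq hk1 hk α hw p M hM]
  apply Finset.sum_nonneg
  intro l _
  have h1 := bcoef_nonneg n k hα l
  have h2 := hC.2 (k - l) (by omega)
  positivity

lemma hess_herm {n : ℕ} {f : E n → ℝ} {x : E n} (hf : ContDiffAt ℝ 2 f x) :
    (hess f x).IsHermitian := by
  ext i j
  simp only [Matrix.conjTranspose_apply, hess, Matrix.of_apply, star_trivial]
  exact pd_comm hf j i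

end glue

/-! ## Part H: jets of the glued function -/

section gluejets
open scoped ContDiff Topology
open Filter

lemma eta_C2 {h h1 h2 : ℝ → ℝ} (d1 : ∀ s, HasDerivAt h (h1 s) s)
    (d2 : ∀ s, HasDerivAt h1 (h2 s) s) (hc : Continuous h2) : ContDiff ℝ 2 h := by
  have e1 : deriv h = h1 := funext fun s => (d1 s).deriv
  have e2 : deriv h1 = h2 := funext fun s => (d2 s).deriv
  have : ContDiff ℝ 1 h1 := by
    rw [contDiff_one_iff_deriv, e2]
    exact ⟨fun s => (d2 s).differentiableAt, hc⟩
  rw [show (2 : ℕ∞ω) = 1 + 1 by norm_num, contDiff_succ_iff_deriv, e1]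
  exact ⟨fun s => (d1 s).differentiableAt, by simp, this⟩

/-- glued function -/
def gl {n : ℕ} (h : ℝ → ℝ) (δ : ℝ) (a b : E n → ℝ) : E n → ℝ :=
  fun y => b y + δ * h ((a y - b y) / δ)

lemma gl_C2 {n : ℕ} {h : ℝ → ℝ} (hh : ContDiff ℝ 2 h) (δ : ℝ) {a b : E n → ℝ} {x : E n}
    (ha : ContDiffAt ℝ 2 a x) (hb : ContDiffAt ℝ 2 b x) : ContDiffAt ℝ 2 (gl h δ a b) x := by
  unfold gl
  exact hb.add (contDiffAt_const.mul (hh.contDiffAt.comp x ((ha.sub hb).div_const δ)))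

lemma gl_pd {n : ℕ} {h h1 : ℝ → ℝ} (d1 : ∀ s, HasDerivAt h (h1 s) s) {δ : ℝ} (hδ : 0 < δ)
    {a b : E n → ℝ} {x : E n} (ha : DifferentiableAt ℝ a x) (hb : DifferentiableAt ℝ b x)
    (j : Fin n) :
    pd (gl h δ a b) j x =
      h1 ((a x - b x) / δ) * pd a j x + (1 - h1 ((a x - b x) / δ)) * pd b j x := by
  have hs : HasFDerivAt (fun y => (a y - b y) / δ) (δ⁻¹ • (fderiv ℝ a x - fderiv ℝ b x)) x := by
    have := (ha.hasFDerivAt.sub hb.hasFDerivAt).const_smul δ⁻¹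
    refine this.congr_of_eventuallyEq (Eventually.of_forall fun y => ?_)
    simp [div_eq_inv_mul]
  have h2 := (d1 ((a x - b x) / δ)).comp_hasFDerivAt x hs
  have h3 := hb.hasFDerivAt.add (h2.const_mul δ)
  have h4 : HasFDerivAt (gl h δ a b) _ x := h3
  unfold pd
  rw [h4.fderiv]
  simp only [_root_.add_apply, _root_.smul_apply, _root_.sub_apply, smul_eq_mul]
  field_simp
  ring

lemma gl_hess {n : ℕ} {h h1 h2 : ℝ → ℝ} (d1 : ∀ s, HasDerivAt h (h1 s) s)
    (d2 : ∀ s, HasDerivAt h1 (h2 s) s) {δ : ℝ} (hδ : 0 < δ)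
    {a b : E n → ℝ} {x : E n} (ha : ContDiffAt ℝ 2 a x) (hb : ContDiffAt ℝ 2 b x) :
    hess (gl h δ a b) x = h1 ((a x - b x) / δ) • hess a x + (1 - h1 ((a x - b x) / δ)) • hess b x
      + (h2 ((a x - b x) / δ) / δ) • Matrix.vecMulVec (fun l => pd a l x - pd b l x)
        (fun l => pd a l x - pd b l x) := by
  have dd : ∀ f : E n → ℝ, ContDiffAt ℝ 2 f x → (∀ᶠ y in 𝓝 x, DifferentiableAt ℝ f y) ∧
      ∀ j, DifferentiableAt ℝ (fun y => pd f j y) x := by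
    intro f hf
    refine ⟨?_, fun j => ?_⟩
    · have := hf.eventually (by simp)
      filter_upwards [this] with y hy
      exact hy.differentiableAt (by simp)
    · have := (hf.fderiv_right (m := 1) (by norm_num)).differentiableAt (by simp)
      exact this.clm_apply (differentiableAt_const _)
  obtain ⟨a1, a2⟩ := dd a ha
  obtain ⟨b1, b2⟩ := dd b hb
  ext i j
  simp only [Matrix.add_apply, Matrix.smul_apply, Matrix.vecMulVec_apply, smul_eq_mul]
  have e : (fun y => pd (gl h δ a b) j y) =ᶠ[𝓝 x] fun y =>
      h1 ((a y - b y) / δ) * pd a j y + (1 - h1 ((a y - b y) / δ)) * pd b j y := by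
    filter_upwards [a1, b1] with y hy1 hy2
    exact gl_pd d1 hδ hy1 hy2 j
  have e2 : hess (gl h δ a b) x i j = pd (fun y => pd (gl h δ a b) j y) i x := rfl
  have ea : hess a x i j = fderiv ℝ (fun y => pd a j y) x (EuclideanSpace.single i 1) := rfl
  have eb : hess b x i j = fderiv ℝ (fun y => pd b j y) x (EuclideanSpace.single i 1) := rfl
  rw [e2, pd_congr e]
  have ha' := a1.self_of_nhds
  have hb' := b1.self_of_nhds
  have hs : HasFDerivAt (fun y => (a y - b y) / δ) (δ⁻¹ • (fderiv ℝ a x - fderiv ℝ b x)) x := by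
    have := (ha'.hasFDerivAt.sub hb'.hasFDerivAt).const_smul δ⁻¹
    refine this.congr_of_eventuallyEq (Eventually.of_forall fun y => ?_)
    simp [div_eq_inv_mul]
  have h3 := (d2 ((a x - b x) / δ)).comp_hasFDerivAt x hs
  have h4 := (h3.mul (a2 j).hasFDerivAt).add ((h3.const_sub 1).mul (b2 j).hasFDerivAt)
  have h5 : HasFDerivAt (fun y => h1 ((a y - b y) / δ) * pd a j y +
    (1 - h1 ((a y - b y) / δ)) * pd b j y) _ x := h4
  rw [ea, eb]
  unfold pd at h5 ⊢
  rw [h5.fderiv]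
  simp only [_root_.add_apply, _root_.smul_apply, _root_.sub_apply, _root_.neg_apply, smul_eq_mul,
    Function.comp]
  field_simp
  ring

/-- jets are continuous on open sets -/
lemma FI_contOn {n : ℕ} (k : ℕ) {α : ℝ} (hα : 0 ≤ α) {Ω : Set (E n)} (hΩ : IsOpen Ω)
    {w : E n → ℝ} (hw : ContDiffOn ℝ 2 w Ω) : ContinuousOn (FI k α w) Ω := by
  have h2 : ∀ j, ContDiffOn ℝ 1 (fun x => pd w j x) Ω := fun j => by
    have h := hw.fderiv_of_isOpen (m := 1) hΩ (by norm_num)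
    unfold pd
    exact h.clm_apply contDiffOn_const
  have h3 : ∀ i j, ContinuousOn (fun x => pd (fun y => pd w j y) i x) Ω := fun i j => by
    have h := (h2 j).continuousOn_fderiv_of_isOpen hΩ le_rfl
    have h' : ContinuousOn (fun x => fderiv ℝ (fun y => pd w j y) x (EuclideanSpace.single i 1)) Ω :=
      h.clm_apply continuousOn_const
    exact h'
  have h4 : ContinuousOn (fun x => hess w x) Ω :=
    continuousOn_pi.2 fun i => continuousOn_pi.2 fun j => h3 i j
  have h5 : ContinuousOn (fun x => (fun l => pd w l x)) Ω :=
    continuousOn_pi.2 fun l => (h2 l).continuousOn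
  have h6 : ContinuousOn (fun x => (w x, (fun l => pd w l x), hess w x)) Ω :=
    hw.continuousOn.prodMk (h5.prodMk h4)
  have h7 := (FF_cont (n := n) k hα).comp_continuousOn h6
  unfold FI
  exact h7

/-- integrability of the integrand -/
lemma FI_integrable {n : ℕ} (k : ℕ) {α : ℝ} (hα : 0 ≤ α) {Ω : Set (E n)} (hΩ : IsOpen Ω)
    (hΩb : Bornology.IsBounded Ω) {w : E n → ℝ} (hw : ContDiffOn ℝ 2 w (closure Ω)) :
    IntegrableOn (FI k α w) Ω := by
  have hcpt : IsCompact (closure Ω) := hΩb.isCompact_closure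
  have hwΩ : ContDiffOn ℝ 2 w Ω := hw.mono subset_closure
  have hloc : ∀ x ∈ closure Ω, ∃ t ∈ 𝓝[closure Ω] x, ∃ C, ∀ y ∈ t ∩ Ω, ∀ m ≤ 2,
      ‖iteratedFDeriv ℝ m w y‖ ≤ C := by
    intro x hx
    obtain ⟨u, hu, p, hp⟩ := (contDiffWithinAt_nat (n := 2)).1 (hw x hx)
    rw [Set.insert_eq_of_mem hx] at hu
    obtain ⟨o, ho, hxo, hou⟩ := mem_nhdsWithin.1 hu
    have hop : HasFTaylorSeriesUpToOn 2 w p (o ∩ Ω) :=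
      hp.mono (fun y hy => hou ⟨hy.1, subset_closure hy.2⟩)
    have hopen : IsOpen (o ∩ Ω) := ho.inter hΩ
    have heq : ∀ m ≤ 2, ∀ y ∈ o ∩ Ω, p y m = iteratedFDeriv ℝ m w y := by
      intro m hm y hy
      rw [hop.eq_iteratedFDerivWithin_of_uniqueDiffOn (by exact_mod_cast hm) hopen.uniqueDiffOn hy]
      exact iteratedFDerivWithin_of_isOpen m hopen hy
    have hb : ∀ m ≤ 2, ∀ᶠ y in 𝓝[u] x, ‖p y m‖ < ‖p x m‖ + 1 := by
      intro m hm
      have hc := (hp.cont m (by exact_mod_cast hm)) x (mem_of_mem_nhdsWithin hx hu)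
      exact hc.norm.eventually (gt_mem_nhds (by linarith))
    have hu' : 𝓝[closure Ω] x ≤ 𝓝[u] x := nhdsWithin_le_of_mem hu
    refine ⟨_, inter_mem (hu' (inter_mem (hb 0 (by norm_num)) (inter_mem (hb 1 (by norm_num))
      (hb 2 (by norm_num))))) (inter_mem_nhdsWithin _ (ho.mem_nhds hxo)),
      (‖p x 0‖ + 1) + (‖p x 1‖ + 1) + (‖p x 2‖ + 1), ?_⟩
    rintro y ⟨⟨⟨h0, h1, h2⟩, h3⟩, hyΩ⟩ m hm
    have hyo : y ∈ o ∩ Ω := ⟨h3.2, hyΩ⟩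
    rw [← heq m hm y hyo]
    change ‖p y 0‖ < ‖p x 0‖ + 1 at h0
    change ‖p y 1‖ < ‖p x 1‖ + 1 at h1
    change ‖p y 2‖ < ‖p x 2‖ + 1 at h2
    have g0 := norm_nonneg (p x 0)
    have g1 := norm_nonneg (p x 1)
    have g2 := norm_nonneg (p x 2)
    interval_cases m <;> linarith
  have hglob : ∃ C, ∀ y ∈ closure Ω ∩ Ω, ∀ m ≤ 2, ‖iteratedFDeriv ℝ m w y‖ ≤ C := by
    refine hcpt.induction_on (p := fun t => ∃ C, ∀ y ∈ t ∩ Ω, ∀ m ≤ 2, ‖iteratedFDeriv ℝ m w y‖ ≤ C)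
      ⟨0, by simp⟩ ?_ ?_ hloc
    · rintro s t hst ⟨C, hC⟩
      exact ⟨C, fun y hy => hC y ⟨hst hy.1, hy.2⟩⟩
    · rintro s t ⟨C, hC⟩ ⟨C', hC'⟩
      refine ⟨max C C', ?_⟩
      rintro y ⟨hy | hy, hyΩ⟩ m hm
      · exact (hC y ⟨hy, hyΩ⟩ m hm).trans (le_max_left _ _)
      · exact (hC' y ⟨hy, hyΩ⟩ m hm).trans (le_max_right _ _)
  obtain ⟨C, hC⟩ := hglob
  have hC' : ∀ y ∈ Ω, ∀ m ≤ 2, ‖iteratedFDeriv ℝ m w y‖ ≤ C :=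
    fun y hy => hC y ⟨subset_closure hy, hy⟩
  obtain ⟨K, hK⟩ := jet_bound _ (FF_cont (n := n) k hα) C
  have hfin : volume Ω ≠ ⊤ := hΩb.measure_lt_top.ne
  have hci : IntegrableOn (fun _ : E n => K) Ω := integrableOn_const hfin
  refine Integrable.mono' hci ((FI_contOn k hα hΩ hwΩ).aestronglyMeasurable hΩ.measurableSet) ?_
  refine (ae_restrict_mem hΩ.measurableSet).mono fun x hx => ?_
  rw [Real.norm_eq_abs]
  apply hK
  · have := hC' x hx 0 (by norm_num)
    rwa [norm_iteratedFDeriv_zero] at this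
  · intro l
    have := hC' x hx 1 (by norm_num)
    rw [norm_iteratedFDeriv_one] at this
    have h2 := (fderiv ℝ w x).le_opNorm (EuclideanSpace.single l 1)
    simp at h2
    exact h2.trans this
  · intro i j
    have h1 := hC' x hx 2 (by norm_num)
    have h2 := (iteratedFDeriv ℝ 2 w x).le_opNorm ![EuclideanSpace.single i 1, EuclideanSpace.single j 1]
    rw [iteratedFDeriv_two_apply] at h2
    simp [Fin.prod_univ_two] at h2
    have hcd : ContDiffAt ℝ 2 w x := hwΩ.contDiffAt (hΩ.mem_nhds hx)
    have hd : DifferentiableAt ℝ (fderiv ℝ w) x :=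
      (hcd.fderiv_right (m := 1) (by norm_num)).differentiableAt (by simp)
    have e : hess w x i j = fderiv ℝ (fderiv ℝ w) x (EuclideanSpace.single i 1)
        (EuclideanSpace.single j 1) := by
      simp only [hess, Matrix.of_apply]
      unfold pd
      rw [fderiv_clm_apply hd (differentiableAt_const _)]
      simp
    have e3 : |hess w x i j| ≤ C := by
      rw [e]
      exact h2.trans h1
    exact e3

end gluejets

/-! ## Part I: the comparison lemma -/

section mainpart
open scoped ContDiff Topology
open Filter

lemma pd_diff {n : ℕ} {f : E n → ℝ} {x : E n} (hf : ContDiffAt ℝ 2 f x) :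
    (∀ᶠ y in 𝓝 x, DifferentiableAt ℝ f y) ∧ ∀ j, DifferentiableAt ℝ (fun y => pd f j y) x := by
  refine ⟨?_, fun j => ?_⟩
  · have := hf.eventually (by simp)
    filter_upwards [this] with y hy
    exact hy.differentiableAt (by simp)
  · have := (hf.fderiv_right (m := 1) (by norm_num)).differentiableAt (by simp)
    exact this.clm_apply (differentiableAt_const _)

lemma pd_lin {n : ℕ} {u v : E n → ℝ} {x : E n} (a b : ℝ) (hu : DifferentiableAt ℝ u x)
    (hv : DifferentiableAt ℝ v x) (j : Fin n) :
    pd (fun y => a * u y + b * v y) j x = a * pd u j x + b * pd v j x := by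
  have h := (hu.hasFDerivAt.const_mul a).add (hv.hasFDerivAt.const_mul b)
  have h' : HasFDerivAt (fun y => a * u y + b * v y) _ x := h
  unfold pd
  rw [h'.fderiv]
  simp

lemma hess_lin {n : ℕ} {u v : E n → ℝ} {x : E n} (a b : ℝ) (hu : ContDiffAt ℝ 2 u x)
    (hv : ContDiffAt ℝ 2 v x) :
    hess (fun y => a * u y + b * v y) x = a • hess u x + b • hess v x := by
  obtain ⟨a1, a2⟩ := pd_diff hu
  obtain ⟨b1, b2⟩ := pd_diff hv
  ext i j
  have e : (fun y => pd (fun y => a * u y + b * v y) j y) =ᶠ[𝓝 x]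
      fun y => a * pd u j y + b * pd v j y := by
    filter_upwards [a1, b1] with y h1 h2
    exact pd_lin a b h1 h2 j
  have e1 : hess (fun y => a * u y + b * v y) x i j =
    pd (fun y => pd (fun y => a * u y + b * v y) j y) i x := rfl
  rw [e1, pd_congr e, pd_lin a b (a2 j) (b2 j) i]
  rfl

lemma pd_scale {n : ℕ} {u : E n → ℝ} {x : E n} (a : ℝ) (hu : DifferentiableAt ℝ u x)
    (j : Fin n) : pd (fun y => a * u y) j x = a * pd u j x := by
  have := pd_lin a 0 hu hu j
  simpa using this

lemma hess_scale {n : ℕ} {u : E n → ℝ} {x : E n} (a : ℝ) (hu : ContDiffAt ℝ 2 u x) :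
    hess (fun y => a * u y) x = a • hess u x := by
  have := hess_lin a 0 hu hu
  simpa using this

lemma AJ_scale {n : ℕ} (c w : ℝ) (p : Fin n → ℝ) (M : Matrix (Fin n) (Fin n) ℝ) :
    AJ (c * w) (fun l => c * p l) (c • M) = (c ^ 2) • AJ w p M := by
  unfold AJ
  have : ∑ l, (c * p l) ^ 2 = c ^ 2 * ∑ l, p l ^ 2 := by
    rw [Finset.mul_sum]
    exact Finset.sum_congr rfl fun l _ => by ring
  rw [this, smul_sub, smul_smul, smul_smul, smul_smul]
  congr 2 <;> ring

/-- on the contact set the jets agree almost everywhere -/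
lemma ae_contact {n : ℕ} (hn : 0 < n) {Ω : Set (E n)} (hΩ : IsOpen Ω) {U V : E n → ℝ}
    (hU : ContDiffOn ℝ 2 U Ω) (hV : ContDiffOn ℝ 2 V Ω) (huv : ∀ x ∈ Ω, V x ≤ U x) :
    ∀ᵐ x ∂(volume.restrict Ω), U x = V x → (∀ j, pd U j x = pd V j x) ∧ hess U x = hess V x := by
  set s : Set (E n) := Ω \ (Ω ∩ (fun x => U x - V x) ⁻¹' {0}ᶜ) with hs
  have hsm : MeasurableSet s := by
    refine hΩ.measurableSet.diff (IsOpen.measurableSet ?_)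
    exact (hU.continuousOn.sub hV.continuousOn).isOpen_inter_preimage hΩ isOpen_compl_singleton
  have hs1 : ∀ x, x ∈ s ↔ x ∈ Ω ∧ U x = V x := by
    intro x
    simp only [hs, Set.mem_sdiff, Set.mem_inter_iff, Set.mem_preimage, Set.mem_compl_iff,
      Set.mem_singleton_iff, not_and, not_not, sub_eq_zero]
    tauto
  have hUa : ∀ x ∈ Ω, ContDiffAt ℝ 2 U x := fun x hx => hU.contDiffAt (hΩ.mem_nhds hx)
  have hVa : ∀ x ∈ Ω, ContDiffAt ℝ 2 V x := fun x hx => hV.contDiffAt (hΩ.mem_nhds hx)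
  have hgrad : ∀ x ∈ s, ∀ j, pd U j x = pd V j x := by
    intro x hx j
    obtain ⟨hx1, hx2⟩ := (hs1 x).1 hx
    have hmin : IsLocalMin (fun y => U y - V y) x := by
      filter_upwards [hΩ.mem_nhds hx1] with y hy
      have := huv y hy
      simp only [hx2]; linarith
    have h0 := hmin.fderiv_eq_zero
    have h1 := ((pd_diff (hUa x hx1)).1.self_of_nhds.hasFDerivAt.sub
      (pd_diff (hVa x hx1)).1.self_of_nhds.hasFDerivAt)
    have h2 : HasFDerivAt (fun y => U y - V y) _ x := h1
    rw [h2.fderiv, sub_eq_zero] at h0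
    unfold pd; rw [h0]
  let e0 : E n := EuclideanSpace.single ⟨0, hn⟩ 1
  have he0 : e0 ≠ 0 := by
    intro h
    have : ‖e0‖ = 1 := by simp [e0]
    rw [h] at this; simp at this
  have hj : ∀ j : Fin n, ∀ᵐ x ∂(volume.restrict s),
      fderiv ℝ (fun y => pd U j y) x = fderiv ℝ (fun y => pd V j y) x := by
    intro j
    have hap : ApproximatesLinearOn (fun x => (pd U j x - pd V j x) • e0) (0 : E n →L[ℝ] E n) s 0 := by
      intro x hx y hy
      simp [hgrad x hx j, hgrad y hy j]
    have := hap.norm_fderiv_sub_le volume hsm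
      (fun x => (fderiv ℝ (fun y => pd U j y) x - fderiv ℝ (fun y => pd V j y) x).smulRight e0)
      (fun x hx => by
        obtain ⟨hx1, hx2⟩ := (hs1 x).1 hx
        have h1 := ((pd_diff (hUa x hx1)).2 j).hasFDerivAt.sub ((pd_diff (hVa x hx1)).2 j).hasFDerivAt
        exact (h1.smul_const e0).hasFDerivWithinAt)
    filter_upwards [this] with x hx
    have h0 : fderiv ℝ (fun y => pd U j y) x - fderiv ℝ (fun y => pd V j y) x = 0 := by
      simpa [he0] using hx
    exact sub_eq_zero.1 h0
  have hall := ae_all_iff.2 hj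
  rw [ae_restrict_iff' hsm] at hall
  rw [ae_restrict_iff' hΩ.measurableSet]
  filter_upwards [hall] with x hx hxΩ hxe
  have hxs := (hs1 x).2 ⟨hxΩ, hxe⟩
  refine ⟨hgrad x hxs, ?_⟩
  ext i j
  have e1 : hess U x i j = fderiv ℝ (fun y => pd U j y) x (EuclideanSpace.single i 1) := rfl
  have e2 : hess V x i j = fderiv ℝ (fun y => pd V j y) x (EuclideanSpace.single i 1) := rfl
  rw [e1, e2, hx hxs j]

/-- scaling limit -/
lemma FI_scale_tendsto {n : ℕ} (k : ℕ) {α : ℝ} (hα : 0 ≤ α) {U : E n → ℝ} {x : E n}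
    (hU : ContDiffAt ℝ 2 U x) (c : ℕ → ℝ) (hc : Tendsto c atTop (𝓝 1)) :
    Tendsto (fun m => FI k α (fun y => c m * U y) x) atTop (𝓝 (FI k α U x)) := by
  have hd := (pd_diff hU).1.self_of_nhds
  have h := jet_tendsto (fun m y => c m * U y) U x
    (by simpa using hc.mul_const (U x))
    (fun l => by
      simp_rw [pd_scale _ hd]
      simpa using hc.mul_const (pd U l x))
    (fun i j => by
      simp_rw [hess_scale _ hU]
      simpa using hc.mul_const (hess U x i j))
  have h2 := ((FF_cont (n := n) k hα).tendsto _).comp h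
  exact h2

end mainpart

/-! ## Part J: the comparison lemma -/

section compare
open scoped ContDiff Topology
open Filter

lemma glue_step {n k : ℕ} (hk1 : 1 ≤ k) (hk : k ≤ n) {α : ℝ} (hα : 0 ≤ α) {Ω : Set (E n)}
    (hΩ : IsOpen Ω) (hΩb : Bornology.IsBounded Ω) {U V : E n → ℝ}
    (hU : ContDiffOn ℝ 2 U (closure Ω)) (hV : ContDiffOn ℝ 2 V (closure Ω))
    (hUp : ∀ x ∈ closure Ω, 0 < U x) (hVp : ∀ x ∈ closure Ω, 0 < V x)
    (hUC : ∀ x ∈ Ω, CM k (AJ (U x) (fun l => pd U l x) (hess U x)))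
    (hVC : ∀ x ∈ Ω, CM k (AJ (V x) (fun l => pd V l x) (hess V x)))
    (hbd : ∀ x ∈ frontier Ω, U x = V x)
    {ε c δ : ℝ} (hε : 0 < ε) (hε1 : ε < 1) (hc : 0 < c) (hcU : ∀ x ∈ closure Ω, c ≤ U x)
    (hδ : δ = ε * c / 2)
    {h h1 h2 : ℝ → ℝ} (d1 : ∀ s, HasDerivAt h (h1 s) s) (d2 : ∀ s, HasDerivAt h1 (h2 s) s)
    (h2c : Continuous h2)
    (hh : ∀ s, 0 ≤ h1 s ∧ h1 s ≤ 1 ∧ 0 ≤ h2 s ∧ 0 ≤ h s ∧ s * h1 s ≤ h s)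
    (hneg : ∀ s ≤ -1, h s = 0) :
    IntegrableOn (FI k α (gl h δ (fun y => (1 - ε) * U y) V)) Ω ∧
    (∀ x ∈ Ω, 0 ≤ FI k α (gl h δ (fun y => (1 - ε) * U y) V) x) ∧
    ∫ x in Ω, FI k α (gl h δ (fun y => (1 - ε) * U y) V) x = ∫ x in Ω, FI k α V x := by
  have hδ0 : 0 < δ := by rw [hδ]; positivity
  set a : E n → ℝ := fun y => (1 - ε) * U y with ha
  set z := gl h δ a V with hz
  have hUΩ : ContDiffOn ℝ 2 U Ω := hU.mono subset_closure
  have hVΩ : ContDiffOn ℝ 2 V Ω := hV.mono subset_closure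
  have hUa : ∀ x ∈ Ω, ContDiffAt ℝ 2 U x := fun x hx => hUΩ.contDiffAt (hΩ.mem_nhds hx)
  have hVa : ∀ x ∈ Ω, ContDiffAt ℝ 2 V x := fun x hx => hVΩ.contDiffAt (hΩ.mem_nhds hx)
  have haa : ∀ x ∈ Ω, ContDiffAt ℝ 2 a x := fun x hx => contDiffAt_const.mul (hUa x hx)
  have hza : ∀ x ∈ Ω, ContDiffAt ℝ 2 z x :=
    fun x hx => gl_C2 (eta_C2 d1 d2 h2c) δ (haa x hx) (hVa x hx)
  have hzΩ : ContDiffOn ℝ 2 z Ω := fun x hx => (hza x hx).contDiffWithinAt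
  have hzV : ∀ x, V x ≤ z x := fun x => by
    have := (hh ((a x - V x) / δ)).2.2.2.1
    have : 0 ≤ δ * h ((a x - V x) / δ) := by positivity
    simp only [hz, gl]; linarith
  have hzp : ∀ x ∈ Ω, 0 < z x := fun x hx => (hVp x (subset_closure hx)).trans_le (hzV x)
  -- the compact set
  let F : E n → ℝ := fun x => a x - V x + δ
  have hFc : ContinuousOn F (closure Ω) :=
    ((continuousOn_const.mul hU.continuousOn).sub hV.continuousOn).add continuousOn_const
  let K : Set (E n) := closure Ω ∩ F ⁻¹' (Set.Ici 0)
  have hKcl : IsClosed K := hFc.preimage_isClosed_of_isClosed isClosed_closure isClosed_Ici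
  have hK : IsCompact K := hΩb.isCompact_closure.of_isClosed_subset hKcl Set.inter_subset_left
  have hKΩ : K ⊆ Ω := by
    rintro x ⟨hx1, hx2⟩
    by_contra hx
    have hfr : x ∈ frontier Ω := by
      rw [hΩ.frontier_eq]; exact ⟨hx1, hx⟩
    have e1 := hbd x hfr
    have e2 : 0 ≤ (1 - ε) * U x - V x + δ := hx2
    have e3 := hcU x hx1
    have e4 : ε * c ≤ ε * U x := by gcongr
    have e5 : 0 < ε * c := by positivity
    rw [hδ] at e2
    nlinarith
  have hzeq : ∀ x ∈ Ω \ K, z x = V x := by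
    rintro x ⟨hx1, hx2⟩
    have e : a x - V x + δ < 0 := by
      by_contra hcon
      exact hx2 ⟨subset_closure hx1, not_lt.1 hcon⟩
    have : (a x - V x) / δ ≤ -1 := by
      rw [div_le_iff₀ hδ0]; linarith
    simp only [hz, gl, hneg _ this]; ring
  have hiV := FI_integrable k hα hΩ hΩb hV
  have hiz : IntegrableOn (FI k α z) Ω := by
    have e : Ω = K ∪ Ω \ K := (Set.union_sdiff_cancel hKΩ).symm
    rw [e]
    refine IntegrableOn.union ?_ ?_
    · exact ((FI_contOn k hα hΩ hzΩ).mono hKΩ).integrableOn_compact hK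
    · refine (hiV.mono_set Set.sdiff_subset).congr_fun ?_ (hΩ.measurableSet.diff hKcl.measurableSet)
      intro x hx
      refine FI_congr k α ?_
      have : IsOpen (Ω \ K) := hΩ.sdiff hKcl
      filter_upwards [this.mem_nhds hx] with y hy
      exact (hzeq y hy).symm
  refine ⟨hiz, ?_, ?_⟩
  · intro x hx
    have hap : 0 < a x := by
      have := hUp x (subset_closure hx)
      have h3 : 0 < 1 - ε := by linarith
      simp only [ha]; positivity
    have hbp := hVp x (subset_closure hx)
    have hUd := (pd_diff (hUa x hx)).1.self_of_nhds
    have hVd := (pd_diff (hVa x hx)).1.self_of_nhds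
    have had := (pd_diff (haa x hx)).1.self_of_nhds
    have hCa : CM k (AJ (a x) (fun l => pd a l x) (hess a x)) := by
      have := CM_smul (hUC x hx) (sq_nonneg (1 - ε))
      rw [← AJ_scale] at this
      have e1 : (fun l => pd a l x) = fun l => (1 - ε) * pd U l x :=
        funext fun l => pd_scale (1 - ε) hUd l
      have e2 : hess a x = (1 - ε) • hess U x := hess_scale (1 - ε) (hUa x hx)
      rw [e1, e2]
      exact this
    set s := (a x - V x) / δ with hs
    obtain ⟨q1, q2, q3, q4, q5⟩ := hh s
    have hr : 0 ≤ h2 s / δ := by positivity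
    have hzz : h1 s * a x + (1 - h1 s) * V x ≤ z x := by
      have e : a x - V x = δ * s := by rw [hs]; field_simp
      have e2 : z x = V x + δ * h s := rfl
      rw [e2]
      have e3 : δ * (s * h1 s) ≤ δ * h s := by gcongr
      have e4 : h1 s * a x + (1 - h1 s) * V x = V x + h1 s * (a x - V x) := by ring
      rw [e4, e]
      linarith
    have hC := cone_comb hk hap hbp (hzp x hx).le q1 (by linarith : 0 ≤ 1 - h1 s) hzz hr
      (fun l => pd a l x - pd V l x) hCa (hVC x hx)
    have e1 : (fun l => pd z l x) = fun l => h1 s * pd a l x + (1 - h1 s) * pd V l x :=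
      funext fun l => gl_pd d1 hδ0 had hVd l
    have e2 : hess z x = _ := gl_hess d1 d2 hδ0 (haa x hx) (hVa x hx)
    rw [← e1] at hC
    rw [← hs] at e2
    rw [← e2] at hC
    exact FF_nonneg hk1 hk hα (hzp x hx) _ _ (hess_herm (hza x hx)) hC
  · exact null_compare k hα hΩ hK hKΩ z V hzΩ hVΩ hzp (fun x hx => hVp x (subset_closure hx))
      hzeq hiz hiV

lemma main_compare {n k : ℕ} (hk1 : 1 ≤ k) (hk : k ≤ n) {α : ℝ} (hα : 0 ≤ α) {Ω : Set (E n)}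
    (hΩ : IsOpen Ω) (hΩb : Bornology.IsBounded Ω) {U V : E n → ℝ}
    (hU : ContDiffOn ℝ 2 U (closure Ω)) (hV : ContDiffOn ℝ 2 V (closure Ω))
    (hUp : ∀ x ∈ closure Ω, 0 < U x) (hVp : ∀ x ∈ closure Ω, 0 < V x)
    (hUC : ∀ x ∈ Ω, CM k (AJ (U x) (fun l => pd U l x) (hess U x)))
    (hVC : ∀ x ∈ Ω, CM k (AJ (V x) (fun l => pd V l x) (hess V x)))
    (huv : ∀ x ∈ Ω, V x ≤ U x) (hbd : ∀ x ∈ frontier Ω, U x = V x) :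
    ∫ x in Ω, FI k α U x ≤ ∫ x in Ω, FI k α V x := by
  have hUΩ : ContDiffOn ℝ 2 U Ω := hU.mono subset_closure
  have hVΩ : ContDiffOn ℝ 2 V Ω := hV.mono subset_closure
  obtain ⟨c, hc, hcU⟩ : ∃ c, 0 < c ∧ ∀ x ∈ closure Ω, c ≤ U x := by
    rcases (closure Ω).eq_empty_or_nonempty with he | hne
    · exact ⟨1, one_pos, fun x hx => by rw [he] at hx; exact absurd hx (Set.notMem_empty x)⟩
    · obtain ⟨x, hx, hm⟩ := hΩb.isCompact_closure.exists_isMinOn hne hU.continuousOn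
      exact ⟨U x, hUp x hx, fun y hy => hm hy⟩
  obtain ⟨h, h1, h2, d1, d2, h2c, hh, hneg, hpos⟩ := exists_eta
  let ε : ℕ → ℝ := fun m => 1 / ((m : ℝ) + 2)
  have hε : ∀ m, 0 < ε m := fun m => by simp only [ε]; positivity
  have hε1 : ∀ m, ε m < 1 := fun m => by
    simp only [ε]; rw [div_lt_one (by positivity)]
    have : (0 : ℝ) ≤ m := Nat.cast_nonneg m
    linarith
  have hε0 : Tendsto ε atTop (𝓝 0) := by
    have := (tendsto_one_div_add_atTop_nhds_zero_nat (𝕜 := ℝ)).comp (tendsto_add_atTop_nat 1)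
    refine this.congr fun m => ?_
    simp only [Function.comp, ε]; push_cast; ring_nf
  let δ : ℕ → ℝ := fun m => ε m * c / 2
  have hδ : ∀ m, 0 < δ m := fun m => by have := hε m; simp only [δ]; positivity
  have hδ0 : Tendsto δ atTop (𝓝 0) := by
    have := (hε0.mul_const c).div_const 2
    simpa using this
  let z : ℕ → E n → ℝ := fun m => gl h (δ m) (fun y => (1 - ε m) * U y) V
  have hstep := fun m => glue_step hk1 hk hα hΩ hΩb hU hV hUp hVp hUC hVC hbd (hε m) (hε1 m) hc hcU
    (rfl : δ m = _) d1 d2 h2c hh hneg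
  have hiU := FI_integrable k hα hΩ hΩb hU
  have hiV := FI_integrable k hα hΩ hΩb hV
  let B : E n → ℝ := fun x => |FI k α U x| + |FI k α V x|
  have hB : IntegrableOn B Ω := hiU.abs.add hiV.abs
  let g : ℕ → E n → ℝ := fun m x => min (FI k α (z m) x) (B x)
  let L : E n → ℝ := fun x => if U x = V x then FI k α V x else FI k α U x
  have hBn : ∀ x, 0 ≤ B x := fun x => by simp only [B]; positivity
  have hgi : ∀ m, IntegrableOn (g m) Ω := fun m => (hstep m).1.inf hB
  have hlim : ∀ x ∈ Ω, Tendsto (fun m => FI k α (z m) x) atTop (𝓝 (L x)) := by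
    intro x hx
    have hxc := subset_closure hx
    have hUc : ContinuousAt U x := hUΩ.continuousOn.continuousAt (hΩ.mem_nhds hx)
    have hVc : ContinuousAt V x := hVΩ.continuousOn.continuousAt (hΩ.mem_nhds hx)
    by_cases hxe : U x = V x
    · simp only [L, if_pos hxe]
      refine tendsto_const_nhds.congr fun m => ?_
      refine (FI_congr k α ?_).symm
      have hlt : (1 - ε m) * U x - V x + δ m < 0 := by
        have e3 := hcU x hxc
        have e4 : ε m * c ≤ ε m * U x := by have := hε m; gcongr
        have e5 : 0 < ε m * c := by have := hε m; positivity
        simp only [δ]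
        nlinarith
      have hcont : ContinuousAt (fun y => (1 - ε m) * U y - V y + δ m) x :=
        ((continuousAt_const.mul hUc).sub hVc).add continuousAt_const
      filter_upwards [hcont.eventually (gt_mem_nhds hlt)] with y hy
      have : ((1 - ε m) * U y - V y) / δ m ≤ -1 := by
        rw [div_le_iff₀ (hδ m)]; linarith
      simp only [z, gl, hneg _ this]; ring
    · simp only [L, if_neg hxe]
      have hgt : 0 < U x - V x := by
        have := huv x hx
        exact sub_pos.2 (lt_of_le_of_ne this (Ne.symm hxe))
      have hUa : ContDiffAt ℝ 2 U x := hUΩ.contDiffAt (hΩ.mem_nhds hx)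
      have ht := FI_scale_tendsto k hα hUa (fun m => 1 - ε m) (by simpa using hε0.const_sub 1)
      refine ht.congr' ?_
      have hev : ∀ᶠ m in atTop, 0 < (1 - ε m) * U x - V x - δ m := by
        have : Tendsto (fun m => (1 - ε m) * U x - V x - δ m) atTop (𝓝 ((1 - 0) * U x - V x - 0)) :=
          (((hε0.const_sub 1).mul_const _).sub_const _).sub hδ0
        refine this.eventually (lt_mem_nhds ?_)
        linarith
      filter_upwards [hev] with m hm
      refine (FI_congr k α ?_).symm
      have hcont : ContinuousAt (fun y => (1 - ε m) * U y - V y - δ m) x :=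
        ((continuousAt_const.mul hUc).sub hVc).sub continuousAt_const
      filter_upwards [hcont.eventually (lt_mem_nhds hm)] with y hy
      have h1' : 1 ≤ ((1 - ε m) * U y - V y) / δ m := by
        rw [le_div_iff₀ (hδ m)]; linarith
      have hd := (hδ m).ne'
      simp only [z, gl, hpos _ h1']
      field_simp
      ring
  have hLB : ∀ x, L x ≤ B x := fun x => by
    have e1 := le_abs_self (FI k α U x)
    have e2 := le_abs_self (FI k α V x)
    have e3 := abs_nonneg (FI k α U x)
    have e4 := abs_nonneg (FI k α V x)
    simp only [L, B]
    split_ifs <;> linarith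
  have hlimg : Tendsto (fun m => ∫ x in Ω, g m x) atTop (𝓝 (∫ x in Ω, L x)) := by
    refine tendsto_integral_of_dominated_convergence B (fun m => (hgi m).aestronglyMeasurable) hB ?_ ?_
    · intro m
      refine (ae_restrict_mem hΩ.measurableSet).mono fun x hx => ?_
      have e1 := (hstep m).2.1 x hx
      rw [Real.norm_eq_abs, abs_of_nonneg (le_min e1 (hBn x))]
      exact min_le_right _ _
    · refine (ae_restrict_mem hΩ.measurableSet).mono fun x hx => ?_
      have := (hlim x hx).min (tendsto_const_nhds (x := B x))
      rwa [min_eq_left (hLB x)] at this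
  have hle : ∫ x in Ω, L x ≤ ∫ x in Ω, FI k α V x := by
    refine le_of_tendsto' hlimg fun m => ?_
    rw [← (hstep m).2.2]
    exact setIntegral_mono (hgi m) (hstep m).1 fun x => min_le_left _ _
  refine le_trans (le_of_eq ?_) hle
  refine integral_congr_ae ?_
  filter_upwards [ae_contact (by omega) hΩ hUΩ hVΩ huv] with x hx
  simp only [L]
  split_ifs with he
  · obtain ⟨g1, g2⟩ := hx he
    unfold FI
    rw [he, g2, funext g1]
  · rfl

end compare

/-! ## Part K: conclusion -/

section concl

lemma AJ_herm {n : ℕ} (w : ℝ) (p : Fin n → ℝ) {M : Matrix (Fin n) (Fin n) ℝ}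
    (hM : M.IsHermitian) : (AJ w p M).IsHermitian := by
  have h : M.transpose = M := by
    rw [← Matrix.conjTranspose_eq_transpose_of_trivial]; exact hM
  rw [Matrix.IsHermitian, Matrix.conjTranspose_eq_transpose_of_trivial]
  simp [AJ, h]

lemma cone_of_eigs {n k : ℕ} {w : E n → ℝ} {x : E n} (hw : ContDiffAt ℝ 2 w x)
    (hG : eigs (Amat w x) ∈ GammaK n k) : CM k (AJ (w x) (fun l => pd w l x) (hess w x)) := by
  have hM := AJ_herm (w x) (fun l => pd w l x) (hess_herm hw)
  refine ⟨hM, fun j hj => ?_⟩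
  rcases Nat.eq_zero_or_pos j with h0 | h0
  · subst h0; rw [HH_zero]; norm_num
  · rw [← Sk_eq j _ hM, ← Amat_eq]
    exact hG j h0 hj

lemma integrand_eq {n k : ℕ} (hk1 : 1 ≤ k) (hk : k ≤ n) (α : ℝ) {w : E n → ℝ} {x : E n}
    (hw : ContDiffAt ℝ 2 w x) (hp : 0 < w x) :
    ∑ l ∈ Finset.range (k + 1), bcoef n k α l * (w x ^ α) * (gradsq w x) ^ l *
      Sk n (k - l) (Amat w x) = FI k α w x := by
  unfold FI
  rw [FF_eq hk1 hk α hp _ _ (hess_herm hw)]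
  refine Finset.sum_congr rfl fun l _ => ?_
  rw [Amat_eq, Sk_eq _ _ (AJ_herm _ _ (hess_herm hw))]
  rfl

lemma integral_eq {n k : ℕ} (hk1 : 1 ≤ k) (hk : k ≤ n) (α : ℝ) {Ω : Set (E n)} (hΩ : IsOpen Ω)
    {w : E n → ℝ} (hw : ContDiffOn ℝ 2 w (closure Ω)) (hp : ∀ x ∈ closure Ω, 0 < w x) :
    ∫ x in Ω, ∑ l ∈ Finset.range (k + 1), bcoef n k α l * (w x ^ α) * (gradsq w x) ^ l *
      Sk n (k - l) (Amat w x) = ∫ x in Ω, FI k α w x := by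
  refine setIntegral_congr_fun hΩ.measurableSet fun x hx => ?_
  exact integrand_eq hk1 hk α ((hw.mono subset_closure).contDiffAt (hΩ.mem_nhds hx))
    (hp x (subset_closure hx))

end concl

theorem stmt15 (n k : ℕ) (hk : 1 ≤ k) (hkn : k ≤ n) (α : ℝ) (hα : 0 ≤ α)
    (Ω : Set (E n)) (hΩ : IsOpen Ω) (hΩb : Bornology.IsBounded Ω)
    (u v : E n → ℝ)
    (hu : ContDiffOn ℝ 2 u (closure Ω)) (hv : ContDiffOn ℝ 2 v (closure Ω))
    (hupos : ∀ x ∈ closure Ω, 0 < u x) (hvpos : ∀ x ∈ closure Ω, 0 < v x)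
    (huG : ∀ x ∈ closure Ω, eigs (Amat u x) ∈ GammaK n k)
    (hvG : ∀ x ∈ closure Ω, eigs (Amat v x) ∈ GammaK n k)
    (huv : ∀ x ∈ Ω, v x ≤ u x) (hbd : ∀ x ∈ frontier Ω, u x = v x) :
    MonotoneOn
      (fun t : ℝ =>
        ∫ x in Ω, ∑ l ∈ Finset.range (k + 1),
          bcoef n k α l * (((1 - t) * u x + t * v x) ^ α) *
            (gradsq (fun y => (1 - t) * u y + t * v y) x) ^ l *
            Sk n (k - l) (Amat (fun y => (1 - t) * u y + t * v y) x))
      (Set.Icc (0 : ℝ) 1) ∧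
    (∫ x in Ω, ∑ l ∈ Finset.range (k + 1),
        bcoef n k α l * (u x ^ α) * (gradsq u x) ^ l * Sk n (k - l) (Amat u x)) ≤
      ∫ x in Ω, ∑ l ∈ Finset.range (k + 1),
        bcoef n k α l * (v x ^ α) * (gradsq v x) ^ l * Sk n (k - l) (Amat v x) := by
  have hC2 : ∀ t : ℝ, ContDiffOn ℝ 2 (fun y => (1 - t) * u y + t * v y) (closure Ω) := fun t =>
    (contDiffOn_const.mul hu).add (contDiffOn_const.mul hv)
  have hua : ∀ x ∈ Ω, ContDiffAt ℝ 2 u x :=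
    fun x hx => (hu.mono subset_closure).contDiffAt (hΩ.mem_nhds hx)
  have hva : ∀ x ∈ Ω, ContDiffAt ℝ 2 v x :=
    fun x hx => (hv.mono subset_closure).contDiffAt (hΩ.mem_nhds hx)
  have huC := fun x (hx : x ∈ Ω) => cone_of_eigs (hua x hx) (huG x (subset_closure hx))
  have hvC := fun x (hx : x ∈ Ω) => cone_of_eigs (hva x hx) (hvG x (subset_closure hx))
  have hpos : ∀ t ∈ Set.Icc (0 : ℝ) 1, ∀ x ∈ closure Ω, 0 < (1 - t) * u x + t * v x := by
    intro t ht x hx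
    have h1 := hupos x hx
    have h2 := hvpos x hx
    rcases eq_or_lt_of_le ht.1 with h | h
    · rw [← h]; simpa using h1
    · have h3 : 0 ≤ (1 - t) * u x := mul_nonneg (by linarith [ht.2]) h1.le
      have h4 : 0 < t * v x := mul_pos h h2
      linarith
  have hcone : ∀ t ∈ Set.Icc (0 : ℝ) 1, ∀ x ∈ Ω,
      CM k (AJ ((1 - t) * u x + t * v x) (fun l => pd (fun y => (1 - t) * u y + t * v y) l x)
        (hess (fun y => (1 - t) * u y + t * v y) x)) := by
    intro t ht x hx
    have hxc := subset_closure hx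
    have h := cone_comb hkn (hupos x hxc) (hvpos x hxc) (hpos t ht x hxc).le
      (by linarith [ht.2] : 0 ≤ 1 - t) ht.1 le_rfl le_rfl (fun _ => 0) (huC x hx) (hvC x hx)
    rw [zero_smul, add_zero, ← hess_lin (1 - t) t (hua x hx) (hva x hx)] at h
    have e : (fun l => pd (fun y => (1 - t) * u y + t * v y) l x) =
        fun l => (1 - t) * pd u l x + t * pd v l x :=
      funext fun l => pd_lin _ _ (pd_diff (hua x hx)).1.self_of_nhds
        (pd_diff (hva x hx)).1.self_of_nhds l
    rw [e]
    exact h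
  refine ⟨?_, ?_⟩
  · intro s hs t ht hst
    change (∫ x in Ω, ∑ l ∈ Finset.range (k + 1), _) ≤ ∫ x in Ω, ∑ l ∈ Finset.range (k + 1), _
    have e1 := integral_eq hk hkn α hΩ (hC2 s) (hpos s hs)
    have e2 := integral_eq hk hkn α hΩ (hC2 t) (hpos t ht)
    refine (le_of_eq e1).trans (le_trans ?_ (le_of_eq e2.symm))
    refine main_compare hk hkn hα hΩ hΩb (hC2 s) (hC2 t) (hpos s hs) (hpos t ht) (hcone s hs)
      (hcone t ht) ?_ ?_
    · intro x hx
      have := huv x hx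
      change (1 - t) * u x + t * v x ≤ (1 - s) * u x + s * v x
      nlinarith
    · intro x hx
      rw [hbd x hx]; ring
  · rw [integral_eq hk hkn α hΩ hu hupos, integral_eq hk hkn α hΩ hv hvpos]
    exact main_compare hk hkn hα hΩ hΩb hu hv hupos hvpos huC hvC huv hbd
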